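/- arXiv:2311.06358 — 5 statements merged into one kernel-verified Lean document; each statement's English description precedes it below -/
import Mathlib

section
/- Fix a positive integer n and natural numbers k, l, m, q. Let π₁ be a Setoid on Fin l ⊕ Fin k and π₂ a Setoid on Fin m ⊕ Fin q. Define the Setoid π on (Fin l ⊕ Fin m) ⊕ (Fin k ⊕ Fin q) by: two elements are related exactly when either both lie in the copy of Fin l ⊕ Fin k (i.e. are of the form Sum.inl (Sum.inl a) or Sum.inr (Sum.inl c)) and their preimages in Fin l ⊕ Fin k are π₁-related, or both lie in the copy of Fin m ⊕ Fin q (i.e. are of the form Sum.inl (Sum.inr b) or Sum.inr (Sum.inr d)) and their preimages in Fin m ⊕ Fin q are π₂-related. Then for all I : Fin l → Fin n, X : Fin m → Fin n, J : Fin k → Fin n, Y : Fin q → Fin n: D_π (Sum.elim I X) (Sum.elim J Y) = (D_{π₁} I J) * (D_{π₂} X Y); i.e. under the natural identification of index types, D_π is the Kronecker product D_{π₁} ⊗ₖ D_{π₂}. -/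
open scoped Classical

/-- The partition matrix `D_π` of a set partition (Setoid) `π` of `α ⊕ β`:
`D_π I J = 1` if `Sum.elim I J` is constant on every block of `π`, else `0`. -/
noncomputable def Dmat (n : ℕ) {α β : Type*} (π : Setoid (α ⊕ β)) :
    Matrix (α → Fin n) (β → Fin n) ℂ :=
  Matrix.of fun I J =>
    if ∀ x y : α ⊕ β, π.r x y → Sum.elim I J x = Sum.elim I J y then 1 else 0

/-- the partition matrix of the disjoint union of two partitions is the
Kronecker product of their partition matrices (stated entrywise). -/
theorem stmt_9 (n : ℕ) (hn : 0 < n) (k l m q : ℕ)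
    (π₁ : Setoid (Fin l ⊕ Fin k)) (π₂ : Setoid (Fin m ⊕ Fin q))
    (π : Setoid ((Fin l ⊕ Fin m) ⊕ (Fin k ⊕ Fin q)))
    (hπ : ∀ x y : (Fin l ⊕ Fin m) ⊕ (Fin k ⊕ Fin q),
      π.r x y ↔
        ((∃ a b : Fin l ⊕ Fin k, π₁.r a b ∧
            x = Sum.map Sum.inl Sum.inl a ∧ y = Sum.map Sum.inl Sum.inl b) ∨
         (∃ c d : Fin m ⊕ Fin q, π₂.r c d ∧
            x = Sum.map Sum.inr Sum.inr c ∧ y = Sum.map Sum.inr Sum.inr d))) :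
    ∀ (I : Fin l → Fin n) (X : Fin m → Fin n) (J : Fin k → Fin n) (Y : Fin q → Fin n),
      Dmat n π (Sum.elim I X) (Sum.elim J Y) = Dmat n π₁ I J * Dmat n π₂ X Y := by
  intro I X J Y
  have elim_inl (a : Fin l ⊕ Fin k) :
      Sum.elim (Sum.elim I X) (Sum.elim J Y) (Sum.map Sum.inl Sum.inl a) = Sum.elim I J a := by
    cases a <;> rfl
  have elim_inr (c : Fin m ⊕ Fin q) :
      Sum.elim (Sum.elim I X) (Sum.elim J Y) (Sum.map Sum.inr Sum.inr c) = Sum.elim X Y c := by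
    cases c <;> rfl
  have constant_iff :
      (∀ x y, π.r x y → Sum.elim (Sum.elim I X) (Sum.elim J Y) x =
        Sum.elim (Sum.elim I X) (Sum.elim J Y) y) ↔
      (∀ a b, π₁.r a b → Sum.elim I J a = Sum.elim I J b) ∧
        ∀ c d, π₂.r c d → Sum.elim X Y c = Sum.elim X Y d := by
    constructor
    · intro h
      refine ⟨fun a b hab => ?_, fun c d hcd => ?_⟩
      · rw [← elim_inl, ← elim_inl]
        exact h _ _ ((hπ _ _).2 (Or.inl ⟨a, b, hab, rfl, rfl⟩))
      · rw [← elim_inr, ← elim_inr]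
        exact h _ _ ((hπ _ _).2 (Or.inr ⟨c, d, hcd, rfl, rfl⟩))
    · rintro ⟨h₁, h₂⟩ x y hxy
      rcases (hπ x y).1 hxy with ⟨a, b, hab, rfl, rfl⟩ | ⟨c, d, hcd, rfl, rfl⟩
      · rw [elim_inl, elim_inl]
        exact h₁ a b hab
      · rw [elim_inr, elim_inr]
        exact h₂ c d hcd
  simp only [Dmat, Matrix.of_apply, constant_iff, ite_zero_mul_ite_zero, mul_one]
end

section
/- Fix a positive integer n and natural numbers k, l, m. Let π₁ be a Setoid on Fin l ⊕ Fin k and π₂ a Setoid on Fin m ⊕ Fin l. On the type T := (Fin m ⊕ Fin l) ⊕ Fin k, let σ be the smallest equivalence relation (the join) containing both the image of π₂ under the embedding Sum.inl : Fin m ⊕ Fin l → T and the image of π₁ under the embedding Fin l ⊕ Fin k → T sending Sum.inl b to Sum.inl (Sum.inr b) and Sum.inr c to Sum.inr c. Define the Setoid π₃ on Fin m ⊕ Fin k by: x ~ y iff ι(x) and ι(y) are σ-related, where ι : Fin m ⊕ Fin k → T sends Sum.inl a to Sum.inl (Sum.inl a) and Sum.inr c to Sum.inr c. Let c be the number of σ-equivalence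 classes that are entirely contained in the middle set {Sum.inl (Sum.inr b) : b ∈ Fin l}. Then D_{π₂} * D_{π₁} = (n : ℂ)^c • D_{π₃}, as matrices in Matrix (Fin m → Fin n) (Fin k → Fin n) ℂ. -/
open scoped Classical

/-- The smallest equivalence relation on `(Fin m ⊕ Fin l) ⊕ Fin k` containing the image
of `π₂` under `Sum.inl` and the image of `π₁` under the embedding sending
`Sum.inl b ↦ Sum.inl (Sum.inr b)` and `Sum.inr c ↦ Sum.inr c`. -/
def concatSetoid (k l m : ℕ) (π₁ : Setoid (Fin l ⊕ Fin k)) (π₂ : Setoid (Fin m ⊕ Fin l)) :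
    Setoid ((Fin m ⊕ Fin l) ⊕ Fin k) :=
  Relation.EqvGen.setoid (fun x y =>
    (∃ a b : Fin m ⊕ Fin l, π₂.r a b ∧ x = Sum.inl a ∧ y = Sum.inl b) ∨
    (∃ a b : Fin l ⊕ Fin k, π₁.r a b ∧
      x = Sum.map Sum.inr id a ∧ y = Sum.map Sum.inr id b))

/-- Given a partition `σ` of `T` and prescribed values `φ` off `M` which are constant on the blocks
of `σ`, the extensions of `φ` to `T` constant on the blocks of `σ` correspond to the free choices
of one value for each block contained in `M`. -/
theorem Setoid.natCard_extensions {T X : Type*} [Finite T] [Finite X] (σ : Setoid T) (M : Set T)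
    (φ : T → X) (hφ : ∀ x y, x ∉ M → y ∉ M → σ.r x y → φ x = φ y) :
    Nat.card {F : T → X // (∀ x y, σ.r x y → F x = F y) ∧ ∀ x, x ∉ M → F x = φ x} =
      Nat.card X ^ {s | s ∈ σ.classes ∧ ∀ x ∈ s, x ∈ M}.ncard := by
  set S : Set (Set T) := {s | s ∈ σ.classes ∧ ∀ x ∈ s, x ∈ M}
  have hrep : ∀ s : S, ∃ x, s.1 = {y | σ.r y x} := fun s => s.2.1
  choose rep rep_spec using hrep
  have hclass : ∀ x, (¬ ∃ y, y ∉ M ∧ σ.r x y) → {y | σ.r y x} ∈ S := fun x hx =>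
    ⟨⟨x, rfl⟩, fun y hy => by_contra fun h => hx ⟨y, h, σ.symm' hy⟩⟩
  have rep_rel : ∀ s : S, ∀ x ∈ s.1, σ.r x (rep s) := fun s x hx => by
    rw [rep_spec s] at hx
    exact hx
  have rep_mem : ∀ s : S, rep s ∈ s.1 := fun s => by
    rw [rep_spec s]
    exact σ.refl' _
  rw [← Nat.card_coe_set_eq, ← Nat.card_fun]
  refine Nat.card_eq_of_bijective (fun F s => F.1 (rep s)) ⟨?_, ?_⟩
  · rintro ⟨F, hF, hFφ⟩ ⟨G, hG, hGφ⟩ h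
    refine Subtype.ext (funext fun x => ?_)
    change F x = G x
    by_cases hx : ∃ y, y ∉ M ∧ σ.r x y
    · obtain ⟨y, hy, hxy⟩ := hx
      rw [hF x y hxy, hG x y hxy, hFφ y hy, hGφ y hy]
    · have hr := rep_rel ⟨_, hclass x hx⟩ x (σ.refl' x)
      rw [hF _ _ hr, hG _ _ hr]
      exact congrFun h ⟨_, hclass x hx⟩
  · intro h
    have hex : ∀ x, ∃ v : X, (∀ y, y ∉ M → σ.r x y → v = φ y) ∧
        ∀ s : S, x ∈ s.1 → v = h s := by
      intro x
      by_cases hx : ∃ y, y ∉ M ∧ σ.r x y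
      · obtain ⟨y, hy, hxy⟩ := hx
        refine ⟨φ y, fun z hz hxz => hφ _ _ hy hz (σ.trans' (σ.symm' hxy) hxz), fun s hs => ?_⟩
        refine absurd (s.2.2 y ?_) hy
        rw [rep_spec s]
        exact σ.trans' (σ.symm' hxy) (rep_rel s x hs)
      · refine ⟨h ⟨_, hclass x hx⟩, fun y hy hxy => absurd ⟨y, hy, hxy⟩ hx, fun s hs => ?_⟩
        exact congrArg h (Subtype.ext (σ.eq_of_mem_classes (hclass x hx).1 (σ.refl' x) s.2.1 hs))
    choose F hFφ hFh using hex
    refine ⟨⟨F, fun x y hxy => ?_, fun x hx => hFφ x x hx (σ.refl' x)⟩,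
      funext fun s => hFh _ s (rep_mem s)⟩
    by_cases hx : ∃ z, z ∉ M ∧ σ.r x z
    · obtain ⟨z, hz, hxz⟩ := hx
      rw [hFφ x z hz hxz, hFφ y z hz (σ.trans' (σ.symm' hxy) hxz)]
    · rw [hFh x ⟨_, hclass x hx⟩ (σ.refl' x), hFh y ⟨_, hclass x hx⟩ (σ.symm' hxy)]

/-- A function is constant on the blocks of the join of `π₂` and `π₁` iff its restrictions to the
two diagrams are constant on the blocks of `π₂` and of `π₁`. -/
theorem concatSetoid_compatible_iff {X : Type*} {k l m : ℕ} (π₁ : Setoid (Fin l ⊕ Fin k))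
    (π₂ : Setoid (Fin m ⊕ Fin l)) (I : Fin m → X) (K : Fin l → X) (J : Fin k → X) :
    (∀ x y, (concatSetoid k l m π₁ π₂).r x y →
        Sum.elim (Sum.elim I K) J x = Sum.elim (Sum.elim I K) J y) ↔
      (∀ x y, π₂.r x y → Sum.elim I K x = Sum.elim I K y) ∧
        ∀ x y, π₁.r x y → Sum.elim K J x = Sum.elim K J y := by
  have hmap : ∀ a : Fin l ⊕ Fin k,
      Sum.elim (Sum.elim I K) J (Sum.map Sum.inr id a) = Sum.elim K J a := by
    rintro (a | a) <;> rfl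
  constructor
  · intro h
    refine ⟨fun x y hxy => h (.inl x) (.inl y) (.rel _ _ (.inl ⟨x, y, hxy, rfl, rfl⟩)),
      fun x y hxy => ?_⟩
    rw [← hmap x, ← hmap y]
    exact h _ _ (.rel _ _ (.inr ⟨x, y, hxy, rfl, rfl⟩))
  · rintro ⟨h₂, h₁⟩ x y hxy
    induction hxy with
    | rel x y h =>
      obtain ⟨a, b, hab, rfl, rfl⟩ | ⟨a, b, hab, rfl, rfl⟩ := h
      · exact h₂ a b hab
      · rw [hmap, hmap]
        exact h₁ a b hab
    | refl => rfl
    | symm _ _ _ ih => exact ih.symm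
    | trans _ _ _ _ _ ih₁ ih₂ => exact ih₁.trans ih₂

/-- composition of partition diagrams.  With `σ` the join above,
`π₃ = σ` pulled back along `Fin m ⊕ Fin k → (Fin m ⊕ Fin l) ⊕ Fin k`, and `c` the
number of `σ`-classes entirely contained in the middle row, one has
`D_{π₂} * D_{π₁} = n ^ c • D_{π₃}`. -/
theorem stmt_10 (n : ℕ) (hn : 0 < n) (k l m : ℕ)
    (π₁ : Setoid (Fin l ⊕ Fin k)) (π₂ : Setoid (Fin m ⊕ Fin l)) :
    Dmat n π₂ * Dmat n π₁ =
      (n : ℂ) ^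
          ({s | s ∈ (concatSetoid k l m π₁ π₂).classes ∧
              ∀ x ∈ s, ∃ b : Fin l, x = Sum.inl (Sum.inr b)}.ncard) •
        Dmat n (Setoid.comap (Sum.map (Sum.inl : Fin m → Fin m ⊕ Fin l) (id : Fin k → Fin k))
          (concatSetoid k l m π₁ π₂)) := by
  set σ := concatSetoid k l m π₁ π₂
  ext I J
  rw [Matrix.mul_apply, Matrix.smul_apply, smul_eq_mul]
  have hsum : ∑ K, Dmat n π₂ I K * Dmat n π₁ K J =
      (Nat.card {K : Fin l → Fin n // ∀ x y, σ.r x y →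
        Sum.elim (Sum.elim I K) J x = Sum.elim (Sum.elim I K) J y} : ℂ) := by
    rw [Nat.card_eq_fintype_card, Fintype.card_subtype, ← Finset.sum_boole]
    refine Finset.sum_congr rfl fun K _ => ?_
    simp only [Dmat, Matrix.of_apply, σ, concatSetoid_compatible_iff]
    split_ifs <;> first | (exfalso; tauto) | simp
  have hmap : ∀ (K : Fin l → Fin n) (a : Fin m ⊕ Fin k),
      Sum.elim (Sum.elim I K) J (Sum.map Sum.inl id a) = Sum.elim I J a := by
    rintro K (a | a) <;> rfl
  rw [hsum, Dmat, Matrix.of_apply]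
  split_ifs with hIJ
  · let φ : (Fin m ⊕ Fin l) ⊕ Fin k → Fin n := Sum.elim (Sum.elim I fun _ => ⟨0, hn⟩) J
    let M : Set ((Fin m ⊕ Fin l) ⊕ Fin k) := {x | ∃ b : Fin l, x = Sum.inl (Sum.inr b)}
    have houter : ∀ x, x ∉ M → ∃ a : Fin m ⊕ Fin k, x = Sum.map Sum.inl id a := by
      rintro ((a | b) | c) hx
      · exact ⟨.inl a, rfl⟩
      · exact absurd ⟨b, rfl⟩ hx
      · exact ⟨.inr c, rfl⟩
    have hcard := σ.natCard_extensions M φ (by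
      intro x y hx hy hxy
      obtain ⟨a, rfl⟩ := houter x hx
      obtain ⟨b, rfl⟩ := houter y hy
      simp only [φ, hmap]
      exact hIJ a b hxy)
    rw [Nat.card_fin] at hcard
    rw [mul_one, ← Nat.cast_pow]
    refine congrArg Nat.cast (Eq.trans (Nat.card_congr ?_) hcard)
    refine
      { toFun := fun K => ⟨Sum.elim (Sum.elim I K.1) J, K.2, fun x hx => ?_⟩
        invFun := fun F => ⟨fun b => F.1 (.inl (.inr b)), ?_⟩
        left_inv := fun K => rfl
        right_inv := fun F => ?_ }
    · obtain ⟨a, rfl⟩ := houter x hx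
      simp only [φ, hmap]
    all_goals
      have hF : Sum.elim (Sum.elim I fun b => F.1 (.inl (.inr b))) J = F.1 := by
        funext x
        by_cases hx : x ∈ M
        · obtain ⟨b, rfl⟩ := hx
          rfl
        · rw [F.2.2 x hx]
          obtain ⟨a, rfl⟩ := houter x hx
          simp only [φ, hmap]
    · rw [hF]
      exact F.2.1
    · exact Subtype.ext hF
  · rw [mul_zero, Nat.cast_eq_zero, Nat.card_eq_zero]
    refine .inl ⟨fun K => hIJ fun x y hxy => ?_⟩
    rw [← hmap K.1 x, ← hmap K.1 y]
    exact K.2 _ _ hxy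
end

section
/- Fix a positive integer n and natural numbers k, l. The set of matrices W : Matrix (Fin l → Fin n) (Fin k → Fin n) ℂ satisfying W * P_σ^{(k)} = P_σ^{(l)} * W for every permutation σ of Fin n is a ℂ-subspace, and it is equal to the ℂ-linear span of the set {D_π : π a Setoid on Fin l ⊕ Fin k} of all partition matrices. (This characterises the weight matrices of symmetric-group equivariant layers: the space of S_n-equivariant linear maps (ℂⁿ)^{⊗k} → (ℂⁿ)^{⊗l} is spanned by the partition matrices of all set partitions of [l+k].) -/
open Matrix
open scoped Classical

/-- The `k`-fold tensor power permutation matrix `P_σ^{(k)}`. -/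
noncomputable def Pmat (n k : ℕ) (σ : Equiv.Perm (Fin n)) :
    Matrix (Fin k → Fin n) (Fin k → Fin n) ℂ :=
  Matrix.of fun I J => if I = ⇑σ ∘ J then 1 else 0

/-- Two functions into a finite type with the same kernel differ by a permutation. -/
theorem exists_perm_comp_eq_of_ker_eq {X Y : Type*} [Finite Y] {f g : X → Y}
    (h : Setoid.ker f = Setoid.ker g) : ∃ σ : Equiv.Perm Y, g = σ ∘ f := by
  cases nonempty_fintype Y
  let e : {y // y ∈ Set.range f} ≃ {y // y ∈ Set.range g} :=
    (Setoid.quotientKerEquivRange f).symm.trans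
      ((Quotient.congrRight fun x y => by rw [h]).trans (Setoid.quotientKerEquivRange g))
  refine ⟨e.extendSubtype, funext fun x => ?_⟩
  have hx : (Setoid.quotientKerEquivRange f).symm ⟨f x, x, rfl⟩ = Quotient.mk _ x := by
    rw [Equiv.symm_apply_eq]; rfl
  rw [Function.comp_apply, e.extendSubtype_apply_of_mem (f x) ⟨x, rfl⟩]
  simp only [e, Equiv.trans_apply, hx]
  rfl

theorem Dmat_apply (n : ℕ) {α β : Type*} (π : Setoid (α ⊕ β)) (I : α → Fin n) (J : β → Fin n) :
    Dmat n π I J = if π ≤ Setoid.ker (Sum.elim I J) then 1 else 0 :=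
  rfl

theorem mul_Pmat_apply {n k : ℕ} {ι : Type*} (W : Matrix ι (Fin k → Fin n) ℂ)
    (σ : Equiv.Perm (Fin n)) (I : ι) (J : Fin k → Fin n) :
    (W * Pmat n k σ) I J = W I (σ ∘ J) := by
  simp [Matrix.mul_apply, Pmat]

theorem Pmat_mul_comp_apply {n l : ℕ} {ι : Type*} (W : Matrix (Fin l → Fin n) ι ℂ)
    (σ : Equiv.Perm (Fin n)) (I : Fin l → Fin n) (J : ι) :
    (Pmat n l σ * W) (σ ∘ I) J = W I J := by
  simp [Matrix.mul_apply, Pmat, σ.injective.comp_left.eq_iff]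

/-- A matrix intertwines the tensor power representations iff its entries are invariant under
the diagonal action on indices. -/
theorem mul_Pmat_eq_Pmat_mul_iff {n k l : ℕ} (W : Matrix (Fin l → Fin n) (Fin k → Fin n) ℂ)
    (σ : Equiv.Perm (Fin n)) :
    W * Pmat n k σ = Pmat n l σ * W ↔ ∀ I J, W (σ ∘ I) (σ ∘ J) = W I J := by
  constructor
  · intro h I J
    rw [← mul_Pmat_apply W σ, h, Pmat_mul_comp_apply]
  · intro h
    ext I J
    obtain ⟨I, rfl⟩ : ∃ I', σ ∘ I' = I := ⟨σ.symm ∘ I, by ext; simp⟩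
    rw [mul_Pmat_apply, Pmat_mul_comp_apply, h]

/-- The indicator matrix of the index pairs whose kernel is exactly `π`. -/
noncomputable def kerMat (n : ℕ) {α β : Type*} (π : Setoid (α ⊕ β)) :
    Matrix (α → Fin n) (β → Fin n) ℂ :=
  Matrix.of fun I J => if Setoid.ker (Sum.elim I J) = π then 1 else 0

theorem Dmat_eq_kerMat_add_sum (n : ℕ) {α β : Type*} [Fintype (Setoid (α ⊕ β))]
    (π : Setoid (α ⊕ β)) :
    Dmat n π = kerMat n π + ∑ ρ : Setoid (α ⊕ β) with π < ρ, kerMat n ρ := by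
  ext I J
  simp only [Dmat_apply, kerMat, Matrix.add_apply, Matrix.sum_apply, Matrix.of_apply,
    Finset.sum_ite_eq, Finset.mem_filter, Finset.mem_univ, true_and]
  by_cases h : Setoid.ker (Sum.elim I J) = π
  · simp [h]
  · simp [h, lt_iff_le_and_ne, Ne.symm h]

instance Setoid.instFinite {α : Type*} [Finite α] : Finite (Setoid α) :=
  Finite.of_injective (fun π => π.r) fun _ _ h =>
    Setoid.ext fun x y => iff_of_eq (congrFun (congrFun h x) y)

theorem kerMat_mem_span_Dmat (n : ℕ) {α β : Type*} [Finite α] [Finite β] (π : Setoid (α ⊕ β)) :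
    kerMat n π ∈ Submodule.span ℂ {D : Matrix (α → Fin n) (β → Fin n) ℂ |
      ∃ π : Setoid (α ⊕ β), D = Dmat n π} := by
  cases nonempty_fintype (Setoid (α ⊕ β))
  induction π using WellFoundedGT.induction with
  | ind π ih =>
    rw [eq_sub_of_add_eq (Dmat_eq_kerMat_add_sum n π).symm]
    refine Submodule.sub_mem _ (Submodule.subset_span ⟨π, rfl⟩) (Submodule.sum_mem _ fun ρ hρ => ?_)
    exact ih ρ (Finset.mem_filter.1 hρ).2

/-- the set of matrices intertwining the tensor power permutation
representations of the symmetric group is the ℂ-linear span of all partition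
matrices `D_π`. -/
theorem stmt_12 (n : ℕ) (hn : 0 < n) (k l : ℕ) :
    {W : Matrix (Fin l → Fin n) (Fin k → Fin n) ℂ |
        ∀ σ : Equiv.Perm (Fin n), W * Pmat n k σ = Pmat n l σ * W} =
      ↑(Submodule.span ℂ
          {D : Matrix (Fin l → Fin n) (Fin k → Fin n) ℂ |
            ∃ π : Setoid (Fin l ⊕ Fin k), D = Dmat n π}) := by
  ext W
  simp only [Set.mem_ofPred_eq, SetLike.mem_coe]
  constructor
  · intro h
    have hW : ∀ I J I' J', Setoid.ker (Sum.elim I J) = Setoid.ker (Sum.elim I' J') →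
        W I J = W I' J' := by
      intro I J I' J' hker
      obtain ⟨σ, hσ⟩ := exists_perm_comp_eq_of_ker_eq hker
      rw [Sum.comp_elim] at hσ
      obtain rfl : I' = σ ∘ I := congrArg (· ∘ Sum.inl) hσ
      obtain rfl : J' = σ ∘ J := congrArg (· ∘ Sum.inr) hσ
      exact ((mul_Pmat_eq_Pmat_mul_iff W σ).1 (h σ) I J).symm
    cases nonempty_fintype (Setoid (Fin l ⊕ Fin k))
    let F : (Fin l → Fin n) × (Fin k → Fin n) → ℂ := fun p => W p.1 p.2
    let K : (Fin l → Fin n) × (Fin k → Fin n) → Setoid (Fin l ⊕ Fin k) :=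
      fun p => Setoid.ker (Sum.elim p.1 p.2)
    have hF : F.FactorsThrough K := fun p q hpq => hW _ _ _ _ hpq
    have hsum : W = ∑ π, Function.extend K F 0 π • kerMat n π := by
      ext I J
      simp only [kerMat, Matrix.sum_apply, Matrix.smul_apply, Matrix.of_apply, smul_eq_mul,
        mul_ite, mul_one, mul_zero, Finset.sum_ite_eq, Finset.mem_univ, if_true]
      exact (hF.extend_apply 0 (I, J)).symm
    rw [hsum]
    exact Submodule.sum_mem _ fun π _ => Submodule.smul_mem _ _ (kerMat_mem_span_Dmat n π)
  · intro h σ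
    induction h using Submodule.span_induction with
    | mem D hD =>
      obtain ⟨π, rfl⟩ := hD
      refine (mul_Pmat_eq_Pmat_mul_iff _ σ).2 fun I J => ?_
      simp only [Dmat, Matrix.of_apply, ← Sum.comp_elim, Function.comp_apply,
        σ.injective.eq_iff]
      congr
    | zero => simp
    | add A B _ _ hA hB => rw [Matrix.add_mul, Matrix.mul_add, hA, hB]
    | smul c A _ hA => rw [Matrix.smul_mul, Matrix.mul_smul, hA]
end

section
/- Fix a positive integer n and natural numbers k, l. The set of matrices W : Matrix (Fin l → Fin n) (Fin k → Fin n) ℂ satisfying W * g^{⊗k} = g^{⊗l} * W for every g in the orthogonal group of n×n real matrices (i.e. g * gᵀ = 1) is a ℂ-subspace, and it is equal to the ℂ-linear span of the set {D_π : π a Setoid on Fin l ⊕ Fin k all of whose equivalence classes have exactly two elements}. (This characterises the weight matrices of orthogonal-group equivariant layers: the O(n)-equivariant maps (ℂⁿ)^{⊗k} → (ℂⁿ)^{⊗l} are spanned by the partition matrices of pair partitions of [l+k].) -/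
open Matrix
open scoped Classical

/-- The `k`-fold tensor power of a real `n × n` matrix, as a complex matrix:
`g^{⊗k} I J = ∏ a, g (I a) (J a)`. -/
noncomputable def tpow (n k : ℕ) (g : Matrix (Fin n) (Fin n) ℝ) :
    Matrix (Fin k → Fin n) (Fin k → Fin n) ℂ :=
  Matrix.of fun I J => ∏ a : Fin k, ((g (I a) (J a) : ℝ) : ℂ)

/-- The tensor of a set partition `π`: the indicator function of the multi-indices that are
constant on the blocks of `π`. -/
noncomputable def partTensor (n : ℕ) {X : Type} (π : Setoid X) : (X → Fin n) → ℂ :=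
  fun I => if ∀ x y, π x y → I x = I y then 1 else 0

/-- A set partition all of whose blocks have exactly two elements. -/
def IsPairing {X : Type} (π : Setoid X) : Prop := ∀ s ∈ π.classes, s.ncard = 2

/-- Invariance of a tensor under the real orthogonal group. -/
def OrthInvariant {n : ℕ} {X : Type} [Fintype X] (T : (X → Fin n) → ℂ) : Prop :=
  ∀ g : Matrix (Fin n) (Fin n) ℝ, g * gᵀ = 1 →
    ∀ I, ∑ J, (∏ x, ((g (I x) (J x) : ℝ) : ℂ)) * T J = T I

theorem sum_mul_eq_ite {n : ℕ} {g : Matrix (Fin n) (Fin n) ℝ} (hg : g * gᵀ = 1) (p q : Fin n) :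
    ∑ j, ((g p j : ℝ) : ℂ) * ((g q j : ℝ) : ℂ) = if p = q then 1 else 0 := by
  have h := congrFun (congrFun hg p) q
  rw [Matrix.mul_apply, Matrix.one_apply] at h
  simp only [Matrix.transpose_apply] at h
  have h' := congrArg (fun r : ℝ => (r : ℂ)) h
  push_cast at h'
  rw [h']
  split_ifs <;> simp

theorem sum_mul_eq_ite' {n : ℕ} {g : Matrix (Fin n) (Fin n) ℝ} (hg : g * gᵀ = 1) (p q : Fin n) :
    ∑ j, ((g j p : ℝ) : ℂ) * ((g j q : ℝ) : ℂ) = if p = q then 1 else 0 :=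
  sum_mul_eq_ite (g := gᵀ) (by rw [Matrix.transpose_transpose]; exact mul_eq_one_comm.mp hg) p q

theorem OrthInvariant.sub {n : ℕ} {X : Type} [Fintype X] {S T : (X → Fin n) → ℂ}
    (hS : OrthInvariant S) (hT : OrthInvariant T) : OrthInvariant (S - T) := by
  intro g hg I
  simp only [Pi.sub_apply, mul_sub, Finset.sum_sub_distrib, hS g hg I, hT g hg I]

theorem OrthInvariant.of_mem_span {n : ℕ} {X : Type} [Fintype X] {A : Set ((X → Fin n) → ℂ)}
    (hA : ∀ T ∈ A, OrthInvariant T) {T : (X → Fin n) → ℂ} (hT : T ∈ Submodule.span ℂ A) :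
    OrthInvariant T := by
  induction hT using Submodule.span_induction with
  | mem T h => exact hA T h
  | zero => intro g hg I; simp
  | add S T _ _ hS hT =>
    intro g hg I
    simp only [Pi.add_apply, mul_add, Finset.sum_add_distrib, hS g hg I, hT g hg I]
  | smul c T _ hT =>
    intro g hg I
    simp only [Pi.smul_apply, smul_eq_mul, mul_left_comm _ c, ← Finset.mul_sum, hT g hg I]

theorem IsPairing.orthInvariant_partTensor {n : ℕ} {X : Type} [Fintype X] {π : Setoid X}
    (hπ : IsPairing π) : OrthInvariant (partTensor n π) := by
  intro g hg I
  have hblock : ∀ q : Quotient π,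
      ∑ j, ∏ x : {x // Quotient.mk π x = q}, ((g (I x) j : ℝ) : ℂ)
        = if ∀ x y, Quotient.mk π x = q → Quotient.mk π y = q → I x = I y then 1 else 0 := by
    intro q
    obtain ⟨z, rfl⟩ := Quotient.exists_rep q
    obtain ⟨u, v, huv, hs⟩ := Set.ncard_eq_two.mp (hπ _ (Setoid.mem_classes π z))
    have hmem : ∀ x, x ∈ ({u, v} : Finset X) ↔ Quotient.mk π x = Quotient.mk π z := by
      intro x
      rw [Quotient.eq]
      have := Set.ext_iff.mp hs x
      simpa using this.symm
    have hp : ∀ j, ∏ x : {x // Quotient.mk π x = Quotient.mk π z}, ((g (I x) j : ℝ) : ℂ)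
        = ((g (I u) j : ℝ) : ℂ) * ((g (I v) j : ℝ) : ℂ) := by
      intro j
      rw [← Finset.prod_subtype ({u, v} : Finset X) hmem (fun x => ((g (I x) j : ℝ) : ℂ)),
        Finset.prod_pair huv]
    simp only [hp, sum_mul_eq_ite hg, ← hmem]
    refine if_congr ?_ rfl rfl
    simp only [Finset.mem_insert, Finset.mem_singleton]
    constructor
    · rintro h x y (rfl | rfl) (rfl | rfl) <;> simp [h]
    · intro h
      exact h u v (Or.inl rfl) (Or.inr rfl)
  have hsum : ∑ K : Quotient π → Fin n, ∏ x, ((g (I x) (K (Quotient.mk π x)) : ℝ) : ℂ)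
      = ∑ J, (∏ x, ((g (I x) (J x) : ℝ) : ℂ)) * partTensor n π J := by
    refine Fintype.sum_of_injective (fun K x => K (Quotient.mk π x)) ?_ _ _ ?_ ?_
    · intro K K' h
      funext q
      obtain ⟨z, rfl⟩ := Quotient.exists_rep q
      exact congrFun h z
    · intro J hJ
      have : ¬ ∀ x y, π x y → J x = J y := by
        intro h
        exact hJ ⟨Quotient.lift J h, rfl⟩
      simp [partTensor, this]
    · intro K
      have : ∀ x y, π x y → K (Quotient.mk π x) = K (Quotient.mk π y) :=
        fun x y h => congrArg K (Quotient.sound h)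
      simp only [partTensor]
      rw [if_pos this, mul_one]
  rw [← hsum]
  have hfib : ∀ K : Quotient π → Fin n, ∏ x, ((g (I x) (K (Quotient.mk π x)) : ℝ) : ℂ)
      = ∏ q, ∏ x : {x // Quotient.mk π x = q}, ((g (I x) (K q) : ℝ) : ℂ) := by
    intro K
    rw [← Fintype.prod_fiberwise (fun x => Quotient.mk π x)]
    refine Finset.prod_congr rfl fun q _ => Finset.prod_congr rfl fun x _ => ?_
    rw [x.2]
  simp only [hfib]
  have := Finset.prod_univ_sum (fun _ : Quotient π => (Finset.univ : Finset (Fin n)))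
    (fun q j => ∏ x : {x // Quotient.mk π x = q}, ((g (I x) j : ℝ) : ℂ))
  rw [Fintype.piFinset_univ] at this
  rw [← this]
  simp only [hblock, partTensor]
  split_ifs with h
  · refine Finset.prod_eq_one fun q _ => if_pos fun x y hx hy => ?_
    exact h x y (Quotient.exact (hx.trans hy.symm))
  · push Not at h
    obtain ⟨x, y, hxy, hne⟩ := h
    refine Finset.prod_eq_zero (Finset.mem_univ (Quotient.mk π y)) (if_neg fun h => hne ?_)
    exact h x y (Quotient.sound hxy) rfl

/-- The multi-index with the value `c` in the slots `a` and `b` and the values of `J` elsewhere. -/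
noncomputable def extendPair {n : ℕ} {X : Type} (a b : X)
    (J : {x // x ≠ a ∧ x ≠ b} → Fin n) (c : Fin n) : X → Fin n :=
  fun x => if h : x ≠ a ∧ x ≠ b then J ⟨x, h⟩ else c

/-- Contraction of a tensor in the slots `a` and `b`. -/
noncomputable def contract {n : ℕ} {X : Type} (a b : X) (T : (X → Fin n) → ℂ) :
    ({x // x ≠ a ∧ x ≠ b} → Fin n) → ℂ :=
  fun J => ∑ c, T (extendPair a b J c)

section Contraction

variable {n : ℕ} {X : Type} {a b : X}

@[simp]
theorem extendPair_left (J : {x // x ≠ a ∧ x ≠ b} → Fin n) (c : Fin n) :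
    extendPair a b J c a = c := by
  simp [extendPair]

@[simp]
theorem extendPair_right (J : {x // x ≠ a ∧ x ≠ b} → Fin n) (c : Fin n) :
    extendPair a b J c b = c := by
  simp [extendPair]

@[simp]
theorem extendPair_coe (J : {x // x ≠ a ∧ x ≠ b} → Fin n) (c : Fin n)
    (y : {x // x ≠ a ∧ x ≠ b}) : extendPair a b J c y = J y := by
  simp [extendPair, y.2.1, y.2.2]

theorem extendPair_restrict {I : X → Fin n} (h : I a = I b) :
    extendPair a b (fun y => I y) (I a) = I := by
  funext x
  by_cases hx : x ≠ a ∧ x ≠ b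
  · simp [extendPair, hx]
  · rw [not_and_or, not_not, not_not] at hx
    rcases hx with rfl | rfl
    · simp
    · simp [h]

theorem update_update_eq_extendPair (I : X → Fin n) (c : Fin n) :
    Function.update (Function.update I a c) b c = extendPair a b (fun y => I y) c := by
  funext x
  by_cases hb : x = b
  · subst hb; simp
  · by_cases ha : x = a
    · subst ha; simp [hb]
    · simp [ha, hb, extendPair]

theorem sum_contract [Fintype X] (F : (X → Fin n) → ℂ) (hF : ∀ I, I a ≠ I b → F I = 0) :
    ∑ J, contract a b F J = ∑ I, F I := by
  simp only [contract]
  rw [← Fintype.sum_prod_type']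
  refine Fintype.sum_of_injective (fun p => extendPair a b p.1 p.2) ?_ _ _ ?_ (fun _ => rfl)
  · rintro ⟨J, c⟩ ⟨J', c'⟩ h
    refine Prod.ext (funext fun y => ?_) ?_
    · simpa using congrFun h (y : X)
    · simpa using congrFun h a
  · intro I hI
    refine hF I fun h => hI ⟨(fun y => I y, I a), extendPair_restrict h⟩

theorem prod_eq_mul_prod_subtype [Fintype X] (hab : a ≠ b) (f : X → ℂ) :
    ∏ x, f x = f a * f b * ∏ y : {x // x ≠ a ∧ x ≠ b}, f y := by
  rw [← Fintype.prod_subtype_mul_prod_subtype (fun x => x ≠ a ∧ x ≠ b) f, mul_comm]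
  congr 1
  rw [← Finset.prod_pair hab]
  symm
  refine Finset.prod_subtype _ (fun x => ?_) f
  simp only [Finset.mem_insert, Finset.mem_singleton]
  tauto

theorem orthInvariant_contract [Fintype X] (hab : a ≠ b) {T : (X → Fin n) → ℂ}
    (hT : OrthInvariant T) : OrthInvariant (contract a b T) := by
  intro g hg I
  have key : ∀ c, T (extendPair a b I c) = ∑ J, (((g c (J a) : ℝ) : ℂ) * ((g c (J b) : ℝ) : ℂ)) *
      ((∏ y : {x // x ≠ a ∧ x ≠ b}, ((g (I y) (J y) : ℝ) : ℂ)) * T J) := by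
    intro c
    rw [← hT g hg (extendPair a b I c)]
    refine Finset.sum_congr rfl fun J _ => ?_
    rw [prod_eq_mul_prod_subtype hab]
    simp only [extendPair_left, extendPair_right, extendPair_coe]
    ring
  conv_rhs => simp only [contract, key]
  rw [Finset.sum_comm]
  simp only [← Finset.sum_mul, sum_mul_eq_ite' hg]
  rw [← sum_contract (a := a) (b := b)]
  · refine Finset.sum_congr (by ext; simp) fun J _ => ?_
    simp [contract, Finset.mul_sum]
  · intro J hJ
    simp [hJ]

/-- The partition of `X` obtained from one of `X \ {a, b}` by adding the block `{a, b}`. -/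
noncomputable def addPair (a b : X) (π : Setoid {x // x ≠ a ∧ x ≠ b}) : Setoid X :=
  Setoid.ker fun x => if h : x ≠ a ∧ x ≠ b then some (Quotient.mk π ⟨x, h⟩) else none

theorem addPair_coe_coe (π : Setoid {x // x ≠ a ∧ x ≠ b}) (x y : {x // x ≠ a ∧ x ≠ b}) :
    addPair a b π x y ↔ π x y := by
  rw [addPair, Setoid.ker_def, dif_pos x.2, dif_pos y.2, Option.some_inj, Quotient.eq]

theorem addPair_of_not (π : Setoid {x // x ≠ a ∧ x ≠ b}) {x y : X} (hy : ¬ (y ≠ a ∧ y ≠ b)) :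
    addPair a b π x y ↔ ¬ (x ≠ a ∧ x ≠ b) := by
  rw [addPair, Setoid.ker_def, dif_neg hy]
  by_cases hx : x ≠ a ∧ x ≠ b
  · simp [hx]
  · simp only [dif_neg hx, true_iff]
    exact hx

theorem isPairing_addPair (hab : a ≠ b) {π : Setoid {x // x ≠ a ∧ x ≠ b}} (hπ : IsPairing π) :
    IsPairing (addPair a b π) := by
  rintro s ⟨y, rfl⟩
  by_cases hy : y ≠ a ∧ y ≠ b
  · have h := hπ _ (Setoid.mem_classes π ⟨y, hy⟩)
    rw [← Set.ncard_image_of_injective _ Subtype.val_injective] at h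
    rw [← h]
    congr 1
    ext x
    constructor
    · intro hx
      have hx' : x ≠ a ∧ x ≠ b := by
        by_contra hx'
        exact (addPair_of_not π hx').mp ((addPair a b π).symm hx) hy
      exact ⟨⟨x, hx'⟩, (addPair_coe_coe π ⟨x, hx'⟩ ⟨y, hy⟩).mp hx, rfl⟩
    · rintro ⟨x, hx, rfl⟩
      exact (addPair_coe_coe π x ⟨y, hy⟩).mpr hx
  · rw [← Set.ncard_pair hab]
    congr 1
    ext x
    change addPair a b π x y ↔ _
    rw [addPair_of_not π hy]
    simp only [Set.mem_insert_iff, Set.mem_singleton_iff]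
    tauto

theorem partTensor_addPair_of_ne (π : Setoid {x // x ≠ a ∧ x ≠ b}) {I : X → Fin n}
    (h : I a ≠ I b) : partTensor n (addPair a b π) I = 0 := by
  refine if_neg fun h' => h (h' a b ?_)
  rw [addPair_of_not π (by simp)]
  simp

theorem partTensor_addPair_extendPair (π : Setoid {x // x ≠ a ∧ x ≠ b})
    (J : {x // x ≠ a ∧ x ≠ b} → Fin n) (c : Fin n) :
    partTensor n (addPair a b π) (extendPair a b J c) = partTensor n π J := by
  refine if_congr ⟨fun h x y hxy => ?_, fun h x y hxy => ?_⟩ rfl rfl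
  · simpa using h x y ((addPair_coe_coe π x y).mpr hxy)
  · by_cases hy : y ≠ a ∧ y ≠ b
    · have hx : x ≠ a ∧ x ≠ b := by
        by_contra hx
        exact (addPair_of_not π hx).mp ((addPair a b π).symm hxy) hy
      have := h ⟨x, hx⟩ ⟨y, hy⟩ ((addPair_coe_coe π ⟨x, hx⟩ ⟨y, hy⟩).mp hxy)
      simpa [extendPair, hx, hy] using this
    · have hx := (addPair_of_not π hy).mp hxy
      simp only [extendPair, dif_neg hx, dif_neg hy]

theorem sum_partTensor_mul_contract [Fintype X] (π : Setoid {x // x ≠ a ∧ x ≠ b})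
    (T : (X → Fin n) → ℂ) :
    ∑ J, partTensor n π J * contract a b T J = ∑ I, partTensor n (addPair a b π) I * T I := by
  rw [← sum_contract (a := a) (b := b)]
  · refine Finset.sum_congr rfl fun J _ => ?_
    simp only [contract, partTensor_addPair_extendPair, Finset.mul_sum]
  · intro I hI
    rw [partTensor_addPair_of_ne π hI, zero_mul]

end Contraction

section Rotation

variable {n : ℕ}

/-- The rotation by the angle `θ` in the plane spanned by the basis vectors `i` and `j`. -/
noncomputable def planeRotation (i j : Fin n) (θ : ℝ) : Matrix (Fin n) (Fin n) ℝ :=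
  1 + (Real.cos θ - 1) • (Matrix.single i i 1 + Matrix.single j j 1)
    + Real.sin θ • (Matrix.single i j 1 - Matrix.single j i 1)

theorem planeRotation_mul_transpose {i j : Fin n} (hij : i ≠ j) (θ : ℝ) :
    planeRotation i j θ * (planeRotation i j θ)ᵀ = 1 := by
  set P : Matrix (Fin n) (Fin n) ℝ := Matrix.single i i 1 + Matrix.single j j 1 with hP
  set A : Matrix (Fin n) (Fin n) ℝ := Matrix.single i j 1 - Matrix.single j i 1 with hA
  have hPP : P * P = P := by simp [hP, add_mul, mul_add, hij, hij.symm]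
  have hPA : P * A = A := by simp [hP, hA, add_mul, mul_sub, hij, hij.symm]
  have hAP : A * P = A := by simp [hP, hA, sub_mul, mul_add, hij, hij.symm]; abel
  have hAA : A * A = -P := by simp [hP, hA, sub_mul, mul_sub, hij, hij.symm]; abel
  have hPt : Pᵀ = P := by simp [hP]
  have hAt : Aᵀ = -A := by simp [hA]
  change (1 + (Real.cos θ - 1) • P + Real.sin θ • A)
    * (1 + (Real.cos θ - 1) • P + Real.sin θ • A)ᵀ = 1
  simp only [Matrix.transpose_add, Matrix.transpose_smul, Matrix.transpose_one, hPt, hAt, add_mul,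
    mul_add, one_mul, mul_one, Matrix.smul_mul, Matrix.mul_smul, mul_neg, smul_neg, hPP, hPA, hAP,
    hAA]
  have h : (2 * (Real.cos θ - 1) + (Real.cos θ - 1) ^ 2 + Real.sin θ ^ 2) = 0 := by
    linarith [Real.sin_sq_add_cos_sq θ]
  calc _ = 1 + (2 * (Real.cos θ - 1) + (Real.cos θ - 1) ^ 2 + Real.sin θ ^ 2) • P := by module
    _ = 1 := by rw [h, zero_smul, add_zero]

theorem planeRotation_zero (i j : Fin n) : planeRotation i j 0 = 1 := by
  simp [planeRotation]

theorem hasDerivAt_planeRotation (i j p q : Fin n) :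
    HasDerivAt (fun θ => ((planeRotation i j θ p q : ℝ) : ℂ))
      ((if p = i then if q = j then 1 else 0 else 0) -
        (if p = j then if q = i then 1 else 0 else 0)) 0 := by
  have h : HasDerivAt (fun θ => planeRotation i j θ p q)
      ((if p = i then if q = j then 1 else 0 else 0) -
        (if p = j then if q = i then 1 else 0 else 0)) 0 := by
    simp only [planeRotation, Matrix.add_apply, Matrix.smul_apply, smul_eq_mul]
    have hc := (((Real.hasDerivAt_cos 0).sub_const 1).mul_const
      ((Matrix.single i i 1 + Matrix.single j j 1 : Matrix (Fin n) (Fin n) ℝ) p q)).const_add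
      ((1 : Matrix (Fin n) (Fin n) ℝ) p q)
    have hs := (Real.hasDerivAt_sin 0).mul_const
      ((Matrix.single i j 1 - Matrix.single j i 1 : Matrix (Fin n) (Fin n) ℝ) p q)
    refine (hc.add hs).congr_deriv ?_
    simp only [Real.sin_zero, Real.cos_zero, neg_zero, zero_mul, zero_add, one_mul,
      Matrix.sub_apply, Matrix.single_apply, ite_and, eq_comm]
  refine h.ofReal_comp.congr_deriv ?_
  split_ifs <;> simp

end Rotation

section ElementaryAction

variable {n : ℕ} {X : Type} [Fintype X]

/-- The action on tensors of the elementary matrix with a one in position `(i, j)`. -/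
noncomputable def elementaryAction (i j : Fin n) (T : (X → Fin n) → ℂ) : (X → Fin n) → ℂ :=
  fun I => ∑ x, if I x = i then T (Function.update I x j) else 0

theorem sum_prod_erase_mul (I : X → Fin n) (x : X) (d : Fin n → ℂ) (T : (X → Fin n) → ℂ) :
    ∑ J, (∏ y ∈ Finset.univ.erase x, if I y = J y then (1 : ℂ) else 0) * d (J x) * T J
      = ∑ q, d q * T (Function.update I x q) := by
  symm
  refine Fintype.sum_of_injective (fun q => Function.update I x q)
    (Function.update_injective I x) _ _ ?_ ?_
  · intro J hJ
    rw [Finset.prod_boole, if_neg, zero_mul, zero_mul]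
    intro h
    refine hJ ⟨J x, ?_⟩
    funext y
    by_cases hy : y = x
    · subst hy; simp
    · simp [hy, h y (by simp [hy])]
  · intro q
    rw [Finset.prod_boole, if_pos]
    · simp
    · intro y hy
      rw [Function.update_of_ne (Finset.ne_of_mem_erase hy)]

theorem OrthInvariant.elementaryAction_comm {T : (X → Fin n) → ℂ} (hT : OrthInvariant T)
    (i j : Fin n) : elementaryAction i j T = elementaryAction j i T := by
  by_cases hij : i = j
  · rw [hij]
  funext I
  have hconst : HasDerivAt
      (fun θ => ∑ J, (∏ x, ((planeRotation i j θ (I x) (J x) : ℝ) : ℂ)) * T J) 0 (0 : ℝ) := by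
    simp only [hT _ (planeRotation_mul_transpose hij _) I]
    exact hasDerivAt_const _ _
  have hder := HasDerivAt.fun_sum (u := Finset.univ) fun J (_ : J ∈ Finset.univ) =>
    (HasDerivAt.fun_finsetProd (u := Finset.univ) fun x (_ : x ∈ Finset.univ) =>
      hasDerivAt_planeRotation i j (I x) (J x)).mul_const (T J)
  have h := hder.unique hconst
  simp only [planeRotation_zero, Matrix.one_apply, smul_eq_mul, Finset.sum_mul] at h
  rw [Finset.sum_comm] at h
  have hx : ∀ x, _ = _ := fun x => sum_prod_erase_mul I x
    (fun q => (if I x = i then if q = j then (1 : ℂ) else 0 else 0) -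
        (if I x = j then if q = i then 1 else 0 else 0)) T
  simp only [apply_ite Complex.ofReal, Complex.ofReal_one, Complex.ofReal_zero, hx] at h
  rw [← sub_eq_zero, ← h]
  simp only [elementaryAction, ← Finset.sum_sub_distrib]
  refine Finset.sum_congr rfl fun x _ => ?_
  simp only [sub_mul, Finset.sum_sub_distrib]
  congr 1 <;> split_ifs <;> simp

theorem OrthInvariant.even_card {T : (X → Fin n) → ℂ} (hT : OrthInvariant T) (i : Fin n)
    {I : X → Fin n} (hI : T I ≠ 0) : Even (Finset.univ.filter fun x => I x = i).card := by
  have hg : Matrix.diagonal (fun p : Fin n => if p = i then (-1 : ℝ) else 1) *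
      (Matrix.diagonal (fun p : Fin n => if p = i then (-1 : ℝ) else 1))ᵀ = 1 := by
    rw [Matrix.diagonal_transpose, Matrix.diagonal_mul_diagonal, ← Matrix.diagonal_one]
    congr 1
    funext p
    split_ifs <;> simp
  have h := hT _ hg I
  rw [Finset.sum_eq_single I] at h
  · have hp : ∏ x, (((Matrix.diagonal (fun p : Fin n => if p = i then (-1 : ℝ) else 1))
        (I x) (I x) : ℝ) : ℂ) = (-1) ^ (Finset.univ.filter fun x => I x = i).card := by
      rw [← Finset.prod_const, Finset.prod_filter]
      refine Finset.prod_congr rfl fun x _ => ?_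
      rw [Matrix.diagonal_apply_eq]
      split_ifs <;> simp
    rw [hp] at h
    by_contra hodd
    rw [Nat.not_even_iff_odd] at hodd
    rw [hodd.neg_one_pow] at h
    exact hI (self_eq_neg.mp (by rw [← neg_one_mul]; exact h.symm))
  · intro J _ hJ
    obtain ⟨x, hx⟩ := Function.ne_iff.mp hJ
    rw [Finset.prod_eq_zero (Finset.mem_univ x), zero_mul]
    rw [Matrix.diagonal_apply_ne _ hx.symm, Complex.ofReal_zero]
  · simp

theorem sum_star_elementaryAction_mul (i j : Fin n) (S T : (X → Fin n) → ℂ) :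
    ∑ I, star (elementaryAction i j S I) * T I = ∑ I, star (S I) * elementaryAction j i T I := by
  simp only [elementaryAction, star_sum, Finset.sum_mul, Finset.mul_sum]
  rw [Finset.sum_comm, Finset.sum_comm (s := Finset.univ (α := X → Fin n)) (t := Finset.univ)]
  refine Finset.sum_congr rfl fun x _ => ?_
  simp only [apply_ite star, star_zero, ite_mul, mul_ite, zero_mul, mul_zero]
  rw [← Finset.sum_filter, ← Finset.sum_filter]
  refine Finset.sum_bij' (fun I _ => Function.update I x j) (fun I _ => Function.update I x i)
    ?_ ?_ ?_ ?_ ?_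
  · simp
  · simp
  · intro I hI
    simp [← (Finset.mem_filter.mp hI).2]
  · intro I hI
    simp [← (Finset.mem_filter.mp hI).2]
  · intro I hI
    simp [← (Finset.mem_filter.mp hI).2]

theorem sum_elementaryAction_elementaryAction {T : (X → Fin n) → ℂ}
    (hT : ∀ a b : X, a ≠ b → contract a b T = 0) (I : X → Fin n) :
    ∑ i, ∑ j, elementaryAction i j (elementaryAction i j T) I = Fintype.card X * T I := by
  have hx : ∀ x y, ∑ j, ∑ i, (if I x = i then if Function.update I x j y = i then
      T (Function.update (Function.update I x j) y j) else 0 else 0)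
        = if x = y then T I else 0 := by
    intro x y
    simp only [Finset.sum_ite_eq, Finset.mem_univ, if_true]
    by_cases hxy : x = y
    · subst hxy
      simp
    · simp only [Function.update_of_ne (Ne.symm hxy), hxy, if_false, update_update_eq_extendPair]
      split_ifs
      · exact congrFun (hT x y hxy) _
      · simp
  calc ∑ i, ∑ j, elementaryAction i j (elementaryAction i j T) I
      = ∑ i, ∑ j, ∑ x, ∑ y, (if I x = i then if Function.update I x j y = i then
          T (Function.update (Function.update I x j) y j) else 0 else 0) := by
        refine Finset.sum_congr rfl fun i _ => Finset.sum_congr rfl fun j _ =>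
          Finset.sum_congr rfl fun x _ => ?_
        split_ifs <;> simp [elementaryAction]
    _ = ∑ x, ∑ y, ∑ j, ∑ i, (if I x = i then if Function.update I x j y = i then
          T (Function.update (Function.update I x j) y j) else 0 else 0) := by
        simp_rw [Finset.sum_comm (s := Finset.univ (α := Fin n)) (t := Finset.univ (α := X))]
        refine Finset.sum_congr rfl fun x _ => Finset.sum_congr rfl fun y _ => Finset.sum_comm
    _ = Fintype.card X * T I := by
        simp_rw [hx]
        simp

theorem elementaryAction_self (i : Fin n) (T : (X → Fin n) → ℂ) (I : X → Fin n) :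
    elementaryAction i i T I = (Finset.univ.filter fun x => I x = i).card * T I := by
  rw [← nsmul_eq_mul, ← Finset.sum_const, Finset.sum_filter]
  refine Finset.sum_congr rfl fun x _ => ?_
  split_ifs with h
  · rw [← h, Function.update_eq_self]
  · rfl

theorem OrthInvariant.eq_zero_of_contract_eq_zero [Nonempty X] {T : (X → Fin n) → ℂ}
    (hT : OrthInvariant T) (hc : ∀ a b : X, a ≠ b → contract a b T = 0) : T = 0 := by
  have hC : ∑ i, ∑ j, ∑ I, star (elementaryAction i j T I) * elementaryAction i j T I
      = Fintype.card X * ∑ I, star (T I) * T I := by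
    simp_rw [sum_star_elementaryAction_mul]
    calc _ = ∑ I, star (T I) * ∑ i, ∑ j, elementaryAction i j (elementaryAction i j T) I := by
          simp_rw [Finset.mul_sum]
          rw [Finset.sum_comm (s := Finset.univ (α := X → Fin n))]
          rw [Finset.sum_comm]
          refine Finset.sum_congr rfl fun j _ => ?_
          rw [Finset.sum_comm]
          refine Finset.sum_congr rfl fun I _ => Finset.sum_congr rfl fun i _ => ?_
          rw [hT.elementaryAction_comm i j]
      _ = _ := by
          simp_rw [sum_elementaryAction_elementaryAction hc, Finset.mul_sum]
          exact Finset.sum_congr rfl fun I _ => by ring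
  have hR : ∑ i, ∑ j, ∑ I, Complex.normSq (elementaryAction i j T I)
      = Fintype.card X * ∑ I, Complex.normSq (T I) := by
    have : ∀ z : ℂ, star z * z = (Complex.normSq z : ℂ) := fun z =>
      Complex.normSq_eq_conj_mul_self.symm
    simp only [this] at hC
    exact_mod_cast hC
  have hdiag : ∀ i, ∑ I, Complex.normSq (elementaryAction i i T I)
      ≤ ∑ j, ∑ I, Complex.normSq (elementaryAction i j T I) := fun i =>
    Finset.single_le_sum (f := fun j => ∑ I, Complex.normSq (elementaryAction i j T I))
      (fun j _ => Finset.sum_nonneg fun I _ => Complex.normSq_nonneg _) (Finset.mem_univ i)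
  have hlow : ∀ i I, 2 * ((Finset.univ.filter fun x => I x = i).card : ℝ) * Complex.normSq (T I)
      ≤ Complex.normSq (elementaryAction i i T I) := by
    intro i I
    rw [elementaryAction_self, Complex.normSq_mul, Complex.normSq_natCast]
    by_cases hI : T I = 0
    · simp [hI]
    · refine mul_le_mul_of_nonneg_right ?_ (Complex.normSq_nonneg _)
      obtain ⟨r, hr⟩ := hT.even_card i hI
      have : 2 * (Finset.univ.filter fun x => I x = i).card
          ≤ (Finset.univ.filter fun x => I x = i).card *
            (Finset.univ.filter fun x => I x = i).card := by
        rw [hr]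
        rcases r with _ | r <;> nlinarith
      exact_mod_cast this
  have hcard : ∀ I : X → Fin n,
      ∑ i, ((Finset.univ.filter fun x => I x = i).card : ℝ) = Fintype.card X := by
    intro I
    have := Finset.card_eq_sum_card_fiberwise (s := Finset.univ) (t := Finset.univ) (f := I)
      (by simp)
    rw [← Finset.card_univ, this]
    push_cast
    rfl
  have hsum : 2 * (Fintype.card X * ∑ I, Complex.normSq (T I))
      ≤ Fintype.card X * ∑ I, Complex.normSq (T I) := by
    calc 2 * (Fintype.card X * ∑ I, Complex.normSq (T I))
        = ∑ I, ∑ i, 2 * ((Finset.univ.filter fun x => I x = i).card : ℝ)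
            * Complex.normSq (T I) := by
          simp_rw [← Finset.sum_mul, ← Finset.mul_sum, hcard, ← Finset.mul_sum]
          ring
      _ = ∑ i, ∑ I, 2 * ((Finset.univ.filter fun x => I x = i).card : ℝ)
            * Complex.normSq (T I) := Finset.sum_comm
      _ ≤ ∑ i, ∑ I, Complex.normSq (elementaryAction i i T I) :=
          Finset.sum_le_sum fun i _ => Finset.sum_le_sum fun I _ => hlow i I
      _ ≤ ∑ i, ∑ j, ∑ I, Complex.normSq (elementaryAction i j T I) :=
          Finset.sum_le_sum fun i _ => hdiag i
      _ = _ := hR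
  have hpos : (0 : ℝ) < Fintype.card X := by exact_mod_cast Fintype.card_pos
  have hnn : 0 ≤ ∑ I, Complex.normSq (T I) := Finset.sum_nonneg fun I _ => Complex.normSq_nonneg _
  have hzero : ∑ I, Complex.normSq (T I) = 0 := by nlinarith
  funext I
  exact Complex.normSq_eq_zero.mp
    ((Finset.sum_eq_zero_iff_of_nonneg fun I _ => Complex.normSq_nonneg _).mp hzero I
      (Finset.mem_univ I))

end ElementaryAction

theorem exists_mem_forall_sum_star_mul_sub_eq_zero {ι : Type} [Fintype ι]
    (S : Submodule ℂ (ι → ℂ)) (v : ι → ℂ) :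
    ∃ p ∈ S, ∀ s ∈ S, ∑ i, star (s i) * (v - p) i = 0 := by
  set S' : Submodule ℂ (EuclideanSpace ℂ ι) :=
    S.comap (WithLp.linearEquiv 2 ℂ (ι → ℂ)).toLinearMap with hS'
  refine ⟨WithLp.ofLp (S'.starProjection (WithLp.toLp 2 v)),
    S'.starProjection_apply_mem (WithLp.toLp 2 v), fun s hs => ?_⟩
  have h := (S'.mem_orthogonal _).mp (S'.sub_starProjection_mem_orthogonal (WithLp.toLp 2 v))
    (WithLp.toLp 2 s) hs
  rw [PiLp.inner_apply] at h
  rw [← h]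
  refine Finset.sum_congr rfl fun i _ => ?_
  rw [RCLike.inner_apply, mul_comm]
  rfl

/-- The span of the tensors of pair partitions. -/
noncomputable def pairingSpan (n : ℕ) (X : Type) : Submodule ℂ ((X → Fin n) → ℂ) :=
  Submodule.span ℂ {T | ∃ π : Setoid X, IsPairing π ∧ T = partTensor n π}

theorem orthInvariant_of_mem_pairingSpan {n : ℕ} {X : Type} [Fintype X] {T : (X → Fin n) → ℂ}
    (hT : T ∈ pairingSpan n X) : OrthInvariant T := by
  refine OrthInvariant.of_mem_span ?_ hT
  rintro _ ⟨π, hπ, rfl⟩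
  exact hπ.orthInvariant_partTensor

@[simp]
theorem star_partTensor {n : ℕ} {X : Type} (π : Setoid X) (I : X → Fin n) :
    star (partTensor n π I) = partTensor n π I := by
  simp only [partTensor]
  split_ifs <;> simp

open scoped ComplexOrder in
theorem eq_zero_of_mem_pairingSpan {n : ℕ} {X : Type} [Fintype X] {T : (X → Fin n) → ℂ}
    (hT : T ∈ pairingSpan n X)
    (h : ∀ π : Setoid X, IsPairing π → ∑ I, partTensor n π I * T I = 0) : T = 0 := by
  have hspan : ∀ S ∈ pairingSpan n X, ∑ I, star (S I) * T I = 0 := by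
    intro S hS
    induction hS using Submodule.span_induction with
    | mem S hS =>
      obtain ⟨π, hπ, rfl⟩ := hS
      simpa using h π hπ
    | zero => simp
    | add S S' _ _ hS hS' =>
      simp only [Pi.add_apply, star_add, add_mul, Finset.sum_add_distrib, hS, hS', add_zero]
    | smul c S _ hS =>
      simp only [Pi.smul_apply, smul_eq_mul, star_mul', mul_assoc, ← Finset.mul_sum, hS, mul_zero]
  exact dotProduct_star_self_eq_zero.mp (hspan T hT)

theorem OrthInvariant.mem_pairingSpan {n : ℕ} {X : Type} [Fintype X] {T : (X → Fin n) → ℂ}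
    (hT : OrthInvariant T) : T ∈ pairingSpan n X := by
  induction hm : Fintype.card X using Nat.strong_induction_on generalizing X with
  | _ m ih =>
    subst hm
    obtain ⟨P, hP, hPT⟩ := exists_mem_forall_sum_star_mul_sub_eq_zero (pairingSpan n X) T
    have horth : ∀ π : Setoid X, IsPairing π → ∑ I, partTensor n π I * (T - P) I = 0 := by
      intro π hπ
      simpa using hPT _ (Submodule.subset_span ⟨π, hπ, rfl⟩)
    have hQ : OrthInvariant (T - P) := hT.sub (orthInvariant_of_mem_pairingSpan hP)
    have hzero : T - P = 0 := by
      rcases isEmpty_or_nonempty X with hX | hX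
      · have hπ : IsPairing (⊤ : Setoid X) := by
          rintro s ⟨x, -⟩
          exact hX.elim x
        funext I
        have h := horth ⊤ hπ
        rw [Fintype.sum_unique, Subsingleton.elim default I] at h
        simpa [partTensor] using h
      · refine hQ.eq_zero_of_contract_eq_zero fun a b hab => ?_
        refine eq_zero_of_mem_pairingSpan
          (ih _ ?_ (orthInvariant_contract hab hQ) rfl) fun π hπ => ?_
        · exact Fintype.card_subtype_lt (x := a) (by simp)
        · have h := sum_partTensor_mul_contract π (T - P)
          rw [horth _ (isPairing_addPair hab hπ)] at h
          convert h
    rw [sub_eq_zero.mp hzero]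
    exact hP

section Matrix

variable {n k l : ℕ}

/-- Tensors indexed by the disjoint union of the rows and columns, viewed as matrices. -/
def tensorToMatrix (n k l : ℕ) :
    ((Fin l ⊕ Fin k → Fin n) → ℂ) →ₗ[ℂ] Matrix (Fin l → Fin n) (Fin k → Fin n) ℂ where
  toFun T := Matrix.of fun A B => T (Sum.elim A B)
  map_add' _ _ := rfl
  map_smul' _ _ := rfl

theorem tensorToMatrix_apply (T : (Fin l ⊕ Fin k → Fin n) → ℂ) (A : Fin l → Fin n)
    (B : Fin k → Fin n) : tensorToMatrix n k l T A B = T (Sum.elim A B) := rfl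

theorem tensorToMatrix_surjective : Function.Surjective (tensorToMatrix n k l) := fun W =>
  ⟨fun I => W (I ∘ Sum.inl) (I ∘ Sum.inr), rfl⟩

theorem tensorToMatrix_injective : Function.Injective (tensorToMatrix n k l) := by
  intro S T h
  funext I
  have h' := congrFun (congrFun h (I ∘ Sum.inl)) (I ∘ Sum.inr)
  simpa [tensorToMatrix_apply] using h'

theorem tpow_mul_transpose {g : Matrix (Fin n) (Fin n) ℝ} (hg : g * gᵀ = 1) (k : ℕ) :
    tpow n k g * (tpow n k g)ᵀ = 1 := by
  ext I K
  simp only [Matrix.mul_apply, tpow, Matrix.of_apply, Matrix.transpose_apply,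
    ← Finset.prod_mul_distrib]
  have h := Finset.prod_univ_sum (fun _ : Fin k => (Finset.univ : Finset (Fin n)))
    (fun a j => ((g (I a) j : ℝ) : ℂ) * ((g (K a) j : ℝ) : ℂ))
  rw [Fintype.piFinset_univ] at h
  rw [← h]
  simp only [sum_mul_eq_ite hg]
  rw [Finset.prod_boole, Matrix.one_apply]
  simp [funext_iff]

theorem tpow_mul_tensorToMatrix_mul_transpose {_ : Fintype (Fin l ⊕ Fin k → Fin n)}
    (g : Matrix (Fin n) (Fin n) ℝ)
    (T : (Fin l ⊕ Fin k → Fin n) → ℂ) (I : Fin l ⊕ Fin k → Fin n) :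
    (tpow n l g * tensorToMatrix n k l T * (tpow n k g)ᵀ) (I ∘ Sum.inl) (I ∘ Sum.inr)
      = ∑ J, (∏ x, ((g (I x) (J x) : ℝ) : ℂ)) * T J := by
  rw [← (Equiv.sumArrowEquivProdArrow (Fin l) (Fin k) (Fin n)).symm.sum_comp,
    Fintype.sum_prod_type_right, Matrix.mul_apply]
  refine Finset.sum_congr rfl fun B _ => ?_
  rw [Matrix.mul_apply, Finset.sum_mul]
  refine Finset.sum_congr rfl fun A _ => ?_
  rw [Fintype.prod_sum_type]
  simp only [tpow, tensorToMatrix_apply, Matrix.of_apply, Matrix.transpose_apply,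
    Function.comp_apply, Equiv.sumArrowEquivProdArrow, Equiv.coe_fn_symm_mk,
    Sum.elim_inl, Sum.elim_inr]
  ring

theorem forall_intertwines_iff_orthInvariant (T : (Fin l ⊕ Fin k → Fin n) → ℂ) :
    (∀ g : Matrix (Fin n) (Fin n) ℝ, g * gᵀ = 1 →
      tensorToMatrix n k l T * tpow n k g = tpow n l g * tensorToMatrix n k l T)
      ↔ OrthInvariant T := by
  refine forall₂_congr fun g hg => ?_
  have h₁ := tpow_mul_transpose hg k
  have h₂ := mul_eq_one_comm.mp h₁
  constructor
  · intro h I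
    refine (tpow_mul_tensorToMatrix_mul_transpose g T I).symm.trans ?_
    rw [← h, Matrix.mul_assoc, h₁, Matrix.mul_one]
    simp [tensorToMatrix_apply]
  · intro h
    have h' : tpow n l g * tensorToMatrix n k l T * (tpow n k g)ᵀ = tensorToMatrix n k l T := by
      ext A B
      exact (tpow_mul_tensorToMatrix_mul_transpose g T (Sum.elim A B)).trans (h (Sum.elim A B))
    conv_lhs => rw [← h', Matrix.mul_assoc, h₂, Matrix.mul_one]

end Matrix

/-- the set of matrices intertwining the tensor power representations of
the orthogonal group `O(n)` is the ℂ-linear span of the partition matrices `D_π` of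
pair partitions (all blocks of size exactly two). -/
theorem stmt_13 (n : ℕ) (hn : 0 < n) (k l : ℕ) :
    {W : Matrix (Fin l → Fin n) (Fin k → Fin n) ℂ |
        ∀ g : Matrix (Fin n) (Fin n) ℝ, g * gᵀ = 1 →
          W * tpow n k g = tpow n l g * W} =
      ↑(Submodule.span ℂ
          {D : Matrix (Fin l → Fin n) (Fin k → Fin n) ℂ |
            ∃ π : Setoid (Fin l ⊕ Fin k),
              (∀ s ∈ π.classes, s.ncard = 2) ∧ D = Dmat n π}) := by
  ext W
  obtain ⟨T, rfl⟩ := tensorToMatrix_surjective W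
  have himage : {D : Matrix (Fin l → Fin n) (Fin k → Fin n) ℂ |
      ∃ π : Setoid (Fin l ⊕ Fin k), (∀ s ∈ π.classes, s.ncard = 2) ∧ D = Dmat n π}
      = tensorToMatrix n k l '' {T | ∃ π, IsPairing π ∧ T = partTensor n π} := by
    ext D
    constructor
    · rintro ⟨π, hπ, rfl⟩
      exact ⟨_, ⟨π, hπ, rfl⟩, rfl⟩
    · rintro ⟨_, ⟨π, hπ, rfl⟩, rfl⟩
      exact ⟨π, hπ, rfl⟩
  rw [Set.mem_ofPred_eq, forall_intertwines_iff_orthInvariant, himage, Submodule.span_image,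
    SetLike.mem_coe]
  constructor
  · exact fun hT => Submodule.mem_map_of_mem hT.mem_pairingSpan
  · rintro ⟨S, hS, hST⟩
    rw [← tensorToMatrix_injective hST]
    exact orthInvariant_of_mem_pairingSpan hS
end

section
/- Fix a positive integer n, natural numbers k, l, and colour words w_k : Fin k → Bool and w_l : Fin l → Bool (false = white ∘, true = black •). For g in the unitary group of n×n complex matrices and a word w : Fin r → Bool, define g^{⊗w} : Matrix (Fin r → Fin n) (Fin r → Fin n) ℂ by g^{⊗w} I J = ∏_{a : Fin r} (if w a then starRingEnd ℂ (g (I a) (J a)) else g (I a) (J a)). Then the set of matrices W : Matrix (Fin l → Fin n) (Fin k → Fin n) ℂ satisfying W * g^{⊗w_k} = g^{⊗w_l} * W for every unitary g is a ℂ-subspace, and it is equal to the ℂ-linear span of the set of partition matrices D_π over all Setoids π on Fin l ⊕ Fin k such that: every equivalence class of π has exactly two elements, and for each class {x, y}: if x and y lie in the same row (both in Fin l, or both in Fin k) then their colours differ, while if they lie in different rows then their colours agree, where the colour of Sum.inl a is w_l a and the colour of Sum.inr b is w_k b. (This characterises the weight matrices of unitary-group equivariant layers between two-coloured tensor power representations,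 a characterisation not previously appearing in the machine learning literature.) -/
open Matrix
open scoped Classical

/-- The two-coloured tensor power `g^{⊗w}` of a complex `n × n` matrix along a colour
word `w : Fin r → Bool` (`false` = white carries `g`, `true` = black carries the
complex conjugate of `g`). -/
noncomputable def tpowW (n r : ℕ) (w : Fin r → Bool) (g : Matrix (Fin n) (Fin n) ℂ) :
    Matrix (Fin r → Fin n) (Fin r → Fin n) ℂ :=
  Matrix.of fun I J =>
    ∏ a : Fin r, if w a then (starRingEnd ℂ) (g (I a) (J a)) else g (I a) (J a)

theorem exists_equivariant_projection {G N : Type*} [Group G] [Fintype G] [Fintype N]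
    [DecidableEq N] (ρ : G →* Matrix N N ℂ) :
    ∃ E : Matrix N N ℂ →ₗ[ℂ] Matrix N N ℂ,
      (∀ Y, E Y ∈ Submodule.span ℂ (Set.range ρ)) ∧ E 1 = 1 ∧
        ∀ g Y, E (ρ g * Y) = ρ g * E Y := by
  set S := Submodule.span ℂ (Set.range ρ)
  have hS : ∀ g, ∀ Y ∈ S, ρ g * Y ∈ S := by
    intro g Y hY
    induction hY using Submodule.span_induction with
    | mem y hy =>
      obtain ⟨h, rfl⟩ := hy
      exact Submodule.subset_span ⟨g * h, map_mul _ _ _⟩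
    | zero => simp
    | add x y _ _ hx hy => rw [mul_add]; exact S.add_mem hx hy
    | smul c x _ hx => rw [mul_smul_comm]; exact S.smul_mem c hx
  obtain ⟨p, hp⟩ := S.subtype.exists_leftInverse_of_injective S.ker_subtype
  have hp1 : ∀ Y (hY : Y ∈ S), p Y = ⟨Y, hY⟩ := fun Y hY => LinearMap.congr_fun hp ⟨Y, hY⟩
  have hcard : (Fintype.card G : ℂ) ≠ 0 := by simp
  refine ⟨(Fintype.card G : ℂ)⁻¹ • ∑ h : G, LinearMap.mulLeft ℂ (ρ h⁻¹) ∘ₗ S.subtype ∘ₗ p ∘ₗ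
    LinearMap.mulLeft ℂ (ρ h), fun Y => ?_, ?_, fun g Y => ?_⟩
  · simp only [LinearMap.smul_apply, LinearMap.sum_apply]
    exact S.smul_mem _ (S.sum_mem fun h _ => hS _ _ (p _).2)
  · have h1 : ∀ h, (p (ρ h) : Matrix N N ℂ) = ρ h := fun h => by
      rw [hp1 _ (Submodule.subset_span ⟨h, rfl⟩)]
    simp [LinearMap.sum_apply, h1, ← map_mul, ← Nat.cast_smul_eq_nsmul ℂ,
      smul_smul]
  · simp only [LinearMap.smul_apply, LinearMap.sum_apply, mul_smul_comm, Finset.mul_sum]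
    congr 1
    refine Fintype.sum_equiv (Equiv.mulRight g) _ _ fun h => ?_
    simp [← mul_assoc, ← map_mul]

/-- The bicommutant of a representation of a finite group is the span of its image. -/
theorem mem_span_range_of_bicommutant {G N : Type*} [Group G] [Fintype G] [Fintype N]
    [DecidableEq N] (ρ : G →* Matrix N N ℂ) (M : Matrix N N ℂ)
    (hM : ∀ X, (∀ g, ρ g * X = X * ρ g) → M * X = X * M) :
    M ∈ Submodule.span ℂ (Set.range ρ) := by
  obtain ⟨E, hES, hE1, hE⟩ := exists_equivariant_projection ρ
  -- the block of `E` mapping column `d` to column `c`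
  let B : N → N → Matrix N N ℂ := fun c d => of fun i j => E (single j d 1) i c
  have hEB : ∀ Y i c, E Y i c = ∑ d, (B c d * Y) i d := by
    intro Y i c
    conv_lhs => rw [matrix_eq_sum_single Y]
    simp only [map_sum, Matrix.sum_apply, mul_apply, B, of_apply]
    rw [Finset.sum_comm]
    refine Finset.sum_congr rfl fun d _ => Finset.sum_congr rfl fun j _ => ?_
    have : single j d (Y j d) = Y j d • single j d (1 : ℂ) := by simp [smul_single]
    rw [this, map_smul, Matrix.smul_apply, smul_eq_mul, mul_comm]
  have hcol : ∀ (X : Matrix N N ℂ) c d j, ∀ i, (X * B c d) i j = (X * E (single j d 1)) i c := by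
    intros; simp [mul_apply, B]
  have hB : ∀ c d g, ρ g * B c d = B c d * ρ g := by
    intro c d g
    ext i j
    rw [hcol, ← hE, hEB, Finset.sum_eq_single d]
    · simp [← mul_assoc]
    · intro e _ he
      rw [← mul_assoc, mul_single_apply_of_ne _ _ _ _ _ he]
    · simp
  have hEM : ∀ Y, E (M * Y) = M * E Y := by
    intro Y
    ext i c
    rw [hEB]
    simp only [← mul_assoc, ← hM _ (hB c _)]
    simp only [mul_assoc]
    rw [Matrix.mul_apply]
    simp only [hEB Y, Finset.mul_sum]
    rw [Finset.sum_comm]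
    exact Finset.sum_congr rfl fun d _ => Matrix.mul_apply
  have := hEM 1
  rw [mul_one, hE1, mul_one] at this
  exact this ▸ hES M

/-- The tensor product of a family of square matrices, indexed by multi-indices. -/
def piMat {α ι : Type*} [Fintype α] (G : α → Matrix ι ι ℂ) : Matrix (α → ι) (α → ι) ℂ :=
  of fun I J => ∏ a, G a (I a) (J a)

theorem piMat_mul {α ι : Type*} [Fintype α] [DecidableEq α] [Fintype ι]
    (G H : α → Matrix ι ι ℂ) : piMat G * piMat H = piMat (G * H) := by
  ext I J
  simp [piMat, mul_apply, Fintype.prod_sum, Finset.prod_mul_distrib]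

theorem piMat_one {α ι : Type*} [Fintype α] [DecidableEq ι] :
    piMat (1 : α → Matrix ι ι ℂ) = 1 := by
  ext I J
  simp [piMat, one_apply, Finset.prod_ite_zero, funext_iff]

theorem piMat_smul_one {α ι : Type*} [Fintype α] [DecidableEq ι] (c : ℂ) :
    piMat (fun _ : α => c • (1 : Matrix ι ι ℂ)) = c ^ Fintype.card α • 1 := by
  rw [← piMat_one]
  ext I J
  simp [piMat, Finset.prod_mul_distrib]

/-- The action of a permutation of the tensor factors. -/
def permMat (α ι : Type*) [Fintype α] [DecidableEq α] [Fintype ι] [DecidableEq ι] :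
    Equiv.Perm α →* Matrix (α → ι) (α → ι) ℂ where
  toFun σ := of fun I J => if I ∘ σ = J then 1 else 0
  map_one' := by ext; simp [one_apply]
  map_mul' σ τ := by
    ext I J
    rw [mul_apply, Finset.sum_eq_single (I ∘ σ)]
    · simp only [of_apply, if_true, one_mul]
      rfl
    · intro K _ hK
      simp [hK.symm]
    · simp

theorem permMat_apply {α ι : Type*} [Fintype α] [DecidableEq α] [Fintype ι] [DecidableEq ι]
    (σ : Equiv.Perm α) (I J : α → ι) : permMat α ι σ I J = if I ∘ σ = J then 1 else 0 := rfl

theorem commute_piMat_diagonal {α ι : Type*} [Fintype α] [DecidableEq α] [Fintype ι]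
    [DecidableEq ι] {M : Matrix (α → ι) (α → ι) ℂ}
    (hM : ∀ g : Matrix ι ι ℂ, g * gᴴ = 1 → gᴴ * g = 1 → Commute M (piMat fun _ => g))
    (z : ι → ℂ) : Commute M (piMat fun _ => diagonal z) := by
  have hpi : ∀ z : ι → ℂ,
      piMat (fun _ : α => diagonal z) = diagonal fun I : α → ι => ∏ a, z (I a) := fun z => by
    ext I J
    by_cases h : I = J
    · subst h; simp [piMat]
    · obtain ⟨a, ha⟩ := Function.ne_iff.1 h
      rw [diagonal_apply_ne _ h]
      exact Finset.prod_eq_zero (Finset.mem_univ a) (diagonal_apply_ne _ ha)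
  have hinf : (Metric.sphere (0 : ℂ) 1).Infinite :=
    (Set.infinite_of_injective_forall_mem (f := fun n : ℤ => (Circle.exp n : ℂ))
      (fun a b h => by
        have := Circle.ext h
        rw [Circle.exp_eq_exp] at this
        obtain ⟨m, hm⟩ := this
        by_contra hab
        have hm0 : m ≠ 0 := by rintro rfl; apply hab; simpa using hm
        refine irrational_pi.ne_rat ((a - b : ℚ) / (2 * m)) ?_
        push_cast
        have : (m : ℝ) ≠ 0 := by exact_mod_cast hm0
        field_simp
        linarith)
      (fun n => (Circle.exp n).2))
  have key : ∀ I J, MvPolynomial.C (M I J) * ∏ a, MvPolynomial.X (J a) =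
      (∏ a, MvPolynomial.X (I a)) * MvPolynomial.C (M I J) := fun I J => by
    refine MvPolynomial.funext_set (fun _ => Metric.sphere (0 : ℂ) 1) (fun _ => hinf)
      fun x hx => ?_
    have hx1 : ∀ i, x i * star (x i) = 1 := fun i => by
      have := hx i trivial
      rw [mem_sphere_zero_iff_norm] at this
      simp [Complex.mul_conj, Complex.normSq_eq_norm_sq, this]
    have := (hM (diagonal x)
      (by rw [diagonal_conjTranspose, diagonal_mul_diagonal]; simpa [funext_iff] using hx1)
      (by rw [diagonal_conjTranspose, diagonal_mul_diagonal]
          simpa [mul_comm, funext_iff] using hx1)).eq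
    rw [hpi] at this
    have := congrFun₂ this I J
    simpa [map_prod] using this
  rw [commute_iff_eq, hpi]
  ext I J
  have := congrArg (MvPolynomial.eval z) (key I J)
  simpa [map_prod] using this

theorem commute_piMat_of_isHermitian {α ι : Type*} [Fintype α] [DecidableEq α] [Fintype ι]
    [DecidableEq ι] {M : Matrix (α → ι) (α → ι) ℂ}
    (hM : ∀ g : Matrix ι ι ℂ, g * gᴴ = 1 → gᴴ * g = 1 → Commute M (piMat fun _ => g))
    {A : Matrix ι ι ℂ} (hA : A.IsHermitian) : Commute M (piMat fun _ => A) := by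
  set U : Matrix ι ι ℂ := hA.eigenvectorUnitary.1
  have hU : U * Uᴴ = 1 := Unitary.mul_star_self_of_mem hA.eigenvectorUnitary.2
  have hU' : Uᴴ * U = 1 := Unitary.star_mul_self_of_mem hA.eigenvectorUnitary.2
  have hAU : A = U * diagonal (RCLike.ofReal ∘ hA.eigenvalues) * Uᴴ := hA.spectral_theorem
  have h : (fun _ : α => A) = (fun _ => U) * (fun _ => diagonal (RCLike.ofReal ∘ hA.eigenvalues)) *
      fun _ => Uᴴ := funext fun _ => hAU
  rw [h, ← piMat_mul, ← piMat_mul]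
  exact ((hM _ hU hU').mul_right (commute_piMat_diagonal hM _)).mul_right
    (hM _ (by simpa using hU') (by simpa using hU))

theorem MvPolynomial.eq_zero_of_eval_isHermitian {ι : Type*} [Fintype ι] [DecidableEq ι]
    (q : MvPolynomial (ι × ι) ℂ)
    (hq : ∀ A : Matrix ι ι ℂ, A.IsHermitian → MvPolynomial.eval (fun x => A x.1 x.2) q = 0) :
    q = 0 := by
  refine MvPolynomial.funext fun x => ?_
  let A : Matrix ι ι ℂ := of fun i j => x (i, j)
  let p : Polynomial ℂ := MvPolynomial.aeval (fun ij : ι × ι =>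
    Polynomial.C ((realPart A : Matrix ι ι ℂ) ij.1 ij.2) +
      Polynomial.X * Polynomial.C ((imaginaryPart A : Matrix ι ι ℂ) ij.1 ij.2)) q
  have hp : ∀ t : ℂ, p.eval t = MvPolynomial.eval (fun ij : ι × ι =>
      ((realPart A : Matrix ι ι ℂ) + t • (imaginaryPart A : Matrix ι ι ℂ)) ij.1 ij.2) q := by
    intro t
    simp only [p, MvPolynomial.aeval_def, ← Polynomial.coe_evalRingHom, MvPolynomial.hom_eval₂]
    rw [MvPolynomial.eval, MvPolynomial.coe_eval₂Hom]
    congr 1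
    · ext; simp
    · ext; simp [mul_comm t]
  have hp0 : p = 0 := by
    refine Polynomial.eq_zero_of_infinite_isRoot p
      ((Set.infinite_range_of_injective Complex.ofReal_injective).mono ?_)
    rintro _ ⟨t, rfl⟩
    rw [Set.mem_ofPred, Polynomial.IsRoot, hp]
    refine hq _ ?_
    refine IsHermitian.add (realPart A).2 ?_
    have := (imaginaryPart A).2.star_eq
    rw [IsHermitian, conjTranspose_smul]
    simp only [star_eq_conjTranspose] at this
    simp [this]
  have h := hp Complex.I
  rw [realPart_add_I_smul_imaginaryPart, hp0] at h
  simpa [A] using h.symm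

theorem exists_perm_of_sum_single_eq {α γ : Type*} [Fintype α] [DecidableEq γ] {f g : α → γ}
    (h : ∑ a, Finsupp.single (f a) 1 = ∑ a, Finsupp.single (g a) 1) :
    ∃ σ : Equiv.Perm α, g ∘ σ = f := by
  have hc : ∀ c, Nonempty ({a // f a = c} ≃ {a // g a = c}) := fun c => by
    have := DFunLike.congr_fun h c
    simp only [Finsupp.finsetSum_apply, Finsupp.single_apply, Finset.sum_boole] at this
    rw [← Fintype.card_eq, Fintype.card_subtype, Fintype.card_subtype]
    exact_mod_cast this
  exact ⟨Equiv.ofFiberEquiv fun c => (hc c).some, funext fun a => Equiv.ofFiberEquiv_map _ a⟩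

/-- Schur–Weyl duality for the unitary group: matrices commuting with all tensor powers of
unitary matrices are linear combinations of permutations of the tensor factors. -/
theorem mem_span_permMat_of_commute {α ι : Type*} [Fintype α] [DecidableEq α] [Fintype ι]
    [DecidableEq ι] {M : Matrix (α → ι) (α → ι) ℂ}
    (hM : ∀ g : Matrix ι ι ℂ, g * gᴴ = 1 → gᴴ * g = 1 → Commute M (piMat fun _ => g)) :
    M ∈ Submodule.span ℂ (Set.range (permMat α ι)) := by
  let m : (α → ι) → (α → ι) → ι × ι →₀ ℕ := fun I J => ∑ a, Finsupp.single (I a, J a) 1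
  have hm : ∀ I J, ∏ a, (MvPolynomial.X (I a, J a) : MvPolynomial (ι × ι) ℂ) =
      MvPolynomial.monomial (m I J) 1 := fun I J => by
    simp [m, MvPolynomial.X, MvPolynomial.monomial_sum_one]
  have key : ∀ I K, ∑ J, MvPolynomial.C (M I J) * MvPolynomial.monomial (m J K) (1 : ℂ) -
      ∑ J, MvPolynomial.C (M J K) * MvPolynomial.monomial (m I J) 1 = 0 := fun I K => by
    refine MvPolynomial.eq_zero_of_eval_isHermitian _ fun A hA => ?_
    have := congrFun₂ (commute_piMat_of_isHermitian hM hA).eq I K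
    simp only [mul_apply, piMat, of_apply] at this
    simp [← hm, map_sum, this, mul_comm]
  refine mem_span_range_of_bicommutant _ M fun X hX => ?_
  have hX' : ∀ (σ : Equiv.Perm α) I J, X (I ∘ σ) (J ∘ σ) = X I J := fun σ I J => by
    have := congrFun₂ (hX σ) I (J ∘ σ)
    simp only [mul_apply, permMat_apply, σ.surjective.injective_comp_right.eq_iff] at this
    simpa using this
  have hXm : ∀ I J I' J', m I J = m I' J' → X I J = X I' J' := fun I J I' J' h => by
    obtain ⟨σ, hσ⟩ := exists_perm_of_sum_single_eq h
    have h1 : I' ∘ σ = I := funext fun a => congrArg Prod.fst (congrFun hσ a)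
    have h2 : J' ∘ σ = J := funext fun a => congrArg Prod.snd (congrFun hσ a)
    rw [← hX' σ I' J', h1, h2]
  let c : (ι × ι →₀ ℕ) → ℂ := Function.extend (fun p : (α → ι) × (α → ι) => m p.1 p.2)
    (fun p => X p.1 p.2) 0
  have hc : ∀ I J, c (m I J) = X I J := fun I J =>
    Function.FactorsThrough.extend_apply (f := fun p : (α → ι) × (α → ι) => m p.1 p.2)
      (g := fun p => X p.1 p.2) (fun p q h => hXm _ _ _ _ h) 0 (I, J)
  ext I K
  let L : MvPolynomial (ι × ι) ℂ →ₗ[ℂ] ℂ := (MvPolynomial.basisMonomials _ ℂ).constr ℂ c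
  have hL : ∀ s, L (MvPolynomial.monomial s 1) = c s := fun s => by
    simpa using (MvPolynomial.basisMonomials _ ℂ).constr_basis ℂ c s
  have := congrArg L (key I K)
  simp only [map_sub, map_sum, MvPolynomial.C_mul', map_smul, hL, hc, map_zero, sub_eq_zero,
    smul_eq_mul] at this
  rw [mul_apply, mul_apply, this]
  exact Finset.sum_congr rfl fun _ _ => mul_comm _ _

theorem piMat_conjTranspose {α ι : Type*} [Fintype α] (G : α → Matrix ι ι ℂ) :
    (piMat G)ᴴ = piMat fun a => (G a)ᴴ := by
  ext I J
  simp [piMat, conjTranspose_apply]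

/-- Move tensor legs between the rows and the columns of a matrix along `s`. -/
def rebend (ι : Type*) {α β γ δ : Type*} (s : α ⊕ β ≃ γ ⊕ δ) :
    Matrix (α → ι) (β → ι) ℂ ≃ₗ[ℂ] Matrix (γ → ι) (δ → ι) ℂ where
  toFun M := of fun I J => M (Sum.elim I J ∘ s ∘ Sum.inl) (Sum.elim I J ∘ s ∘ Sum.inr)
  invFun W := of fun K L =>
    W (Sum.elim K L ∘ s.symm ∘ Sum.inl) (Sum.elim K L ∘ s.symm ∘ Sum.inr)
  map_add' _ _ := rfl
  map_smul' _ _ := rfl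
  left_inv M := by
    ext K L
    simp [← Function.comp_assoc, Sum.elim_comp_inl_inr]
    simp [Function.comp_assoc]
  right_inv W := by
    ext I J
    simp [← Function.comp_assoc, Sum.elim_comp_inl_inr]
    simp [Function.comp_assoc]

theorem rebend_apply {ι α β γ δ : Type*} (s : α ⊕ β ≃ γ ⊕ δ) (M : Matrix (α → ι) (β → ι) ℂ)
    (I : γ → ι) (J : δ → ι) : rebend ι s M I J =
      M (Sum.elim I J ∘ s ∘ Sum.inl) (Sum.elim I J ∘ s ∘ Sum.inr) := rfl

theorem piMat_mul_mul_transpose_apply {α β ι : Type*} [Fintype α] [DecidableEq α] [Fintype β]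
    [DecidableEq β] [Fintype ι] (A : α → Matrix ι ι ℂ) (B : β → Matrix ι ι ℂ)
    (W : Matrix (α → ι) (β → ι) ℂ) (I : α → ι) (J : β → ι) :
    (piMat A * W * (piMat B)ᵀ) I J = ∑ f : α ⊕ β → ι,
      piMat (Sum.elim A B) (Sum.elim I J) f * W (f ∘ Sum.inl) (f ∘ Sum.inr) := by
  rw [← (Equiv.sumArrowEquivProdArrow α β ι).symm.sum_comp, Fintype.sum_prod_type_right]
  simp [mul_apply, piMat, Finset.sum_mul, Equiv.sumArrowEquivProdArrow, Fintype.prod_sum_type,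
    mul_right_comm]

theorem rebend_piMat_mul_mul_transpose {α β γ δ ι : Type*} [Fintype α] [DecidableEq α]
    [Fintype β] [DecidableEq β] [Fintype γ] [DecidableEq γ] [Fintype δ] [DecidableEq δ]
    [Fintype ι] (s : α ⊕ β ≃ γ ⊕ δ) {A : α → Matrix ι ι ℂ} {B : β → Matrix ι ι ℂ}
    {C : γ → Matrix ι ι ℂ} {D : δ → Matrix ι ι ℂ} (h : Sum.elim C D ∘ s = Sum.elim A B)
    (M : Matrix (α → ι) (β → ι) ℂ) :
    rebend ι s (piMat A * M * (piMat B)ᵀ) = piMat C * rebend ι s M * (piMat D)ᵀ := by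
  ext I J
  rw [rebend_apply, piMat_mul_mul_transpose_apply, piMat_mul_mul_transpose_apply]
  refine Fintype.sum_equiv (s.arrowCongr (Equiv.refl ι)) _ _ fun f => ?_
  congr 1
  · rw [← h]
    simp only [piMat, of_apply]
    refine Fintype.prod_equiv s _ _ fun x => ?_
    cases x <;> simp
  · simp only [rebend_apply]
    congr 1 <;> ext <;> simp

/-- `g` or its entrywise conjugate, according to a colour. -/
def conjIf {ι : Type*} (b : Bool) (g : Matrix ι ι ℂ) : Matrix ι ι ℂ :=
  if b then g.map (starRingEnd ℂ) else g

theorem conjIf_mul {ι : Type*} [Fintype ι] (b : Bool) (g h : Matrix ι ι ℂ) :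
    conjIf b g * conjIf b h = conjIf b (g * h) := by
  cases b <;> simp [conjIf, Matrix.map_mul]

theorem conjIf_one {ι : Type*} [DecidableEq ι] (b : Bool) :
    conjIf b (1 : Matrix ι ι ℂ) = 1 := by
  cases b <;> simp [conjIf]

theorem conjIf_conjTranspose {ι : Type*} (b : Bool) (g : Matrix ι ι ℂ) :
    conjIf b gᴴ = (conjIf b g)ᴴ := by
  cases b <;> ext <;> simp [conjIf]

theorem conjTranspose_piMat_conjIf {α ι : Type*} [Fintype α] (w : α → Bool)
    (g : Matrix ι ι ℂ) :
    (piMat fun a => conjIf (w a) g)ᴴ = (piMat fun a => conjIf (!w a) g)ᵀ := by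
  ext I J
  simp only [conjTranspose_apply, transpose_apply, piMat, of_apply, star_prod]
  refine Finset.prod_congr rfl fun a _ => ?_
  cases w a <;> simp [conjIf]

theorem tpowW_eq_piMat (n r : ℕ) (w : Fin r → Bool) (g : Matrix (Fin n) (Fin n) ℂ) :
    tpowW n r w g = piMat fun a => conjIf (w a) g := by
  ext I J
  simp only [tpowW, piMat, of_apply]
  refine Finset.prod_congr rfl fun a _ => ?_
  cases w a <;> simp [conjIf]

theorem piMat_conjIf_mul_conjTranspose {α ι : Type*} [Fintype α] [DecidableEq α] [Fintype ι]
    [DecidableEq ι] (w : α → Bool) {g : Matrix ι ι ℂ} (hg : g * gᴴ = 1) :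
    (piMat fun a => conjIf (w a) g) * (piMat fun a => conjIf (w a) g)ᴴ = 1 := by
  rw [piMat_conjTranspose, piMat_mul, ← piMat_one]
  congr 1
  ext1 a
  rw [Pi.mul_apply, ← conjIf_conjTranspose, conjIf_mul, hg, conjIf_one, Pi.one_apply]

theorem mul_eq_mul_iff_of_mul_conjTranspose {N N' : Type*} [Fintype N] [DecidableEq N]
    [Fintype N'] {V : Matrix N N ℂ} (hV : V * Vᴴ = 1) (U : Matrix N' N' ℂ)
    (W : Matrix N' N ℂ) : W * V = U * W ↔ U * W * Vᴴ = W := by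
  have hV' : Vᴴ * V = 1 := mul_eq_one_comm.1 hV
  constructor
  · intro h
    rw [← h, Matrix.mul_assoc, hV, Matrix.mul_one]
  · intro h
    conv_lhs => rw [← h]
    rw [Matrix.mul_assoc, hV', Matrix.mul_one]

/-- The colour of a vertex, with the colours of the bottom row flipped. -/
def signColour {α β : Type*} (u : α → Bool) (w : β → Bool) : α ⊕ β → Bool :=
  Sum.elim u fun b => !w b

theorem rebend_intertwines_iff {α β γ δ ι : Type*} [Fintype α] [DecidableEq α]
    [Fintype β] [DecidableEq β] [Fintype γ] [DecidableEq γ] [Fintype δ] [DecidableEq δ]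
    [Fintype ι] [DecidableEq ι] (s : α ⊕ β ≃ γ ⊕ δ) {u : γ → Bool} {w : δ → Bool}
    (hs : ∀ x, signColour u w (s x) = x.isRight) {g : Matrix ι ι ℂ} (hg : g * gᴴ = 1)
    (M : Matrix (α → ι) (β → ι) ℂ) :
    rebend ι s M * piMat (fun b : δ => conjIf (w b) g) =
        piMat (fun a : γ => conjIf (u a) g) * rebend ι s M ↔
      M * piMat (fun _ : β => g) = piMat (fun _ : α => g) * M := by
  have hα : piMat (fun _ : α => g) = piMat fun _ : α => conjIf false g := rfl
  have hβ : piMat (fun _ : β => g) = piMat fun _ : β => conjIf false g := rfl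
  rw [hα, hβ, mul_eq_mul_iff_of_mul_conjTranspose (piMat_conjIf_mul_conjTranspose w hg),
    mul_eq_mul_iff_of_mul_conjTranspose (piMat_conjIf_mul_conjTranspose (fun _ => false) hg),
    conjTranspose_piMat_conjIf, conjTranspose_piMat_conjIf, ← (rebend ι s).injective.eq_iff,
    rebend_piMat_mul_mul_transpose s]
  have h : ∀ y, Sum.elim (fun a => conjIf (u a) g) (fun a => conjIf (!w a) g) y =
      conjIf (signColour u w y) g := by
    rintro (y | y) <;> rfl
  ext1 x
  rw [Function.comp_apply, h, hs]
  cases x <;> rfl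

/-- The pair partition whose blocks are `{s (inl a), s (inr a)}`. -/
def pairSetoid {α X : Type*} (s : α ⊕ α ≃ X) : Setoid X :=
  Setoid.ker (Sum.elim id id ∘ s.symm)

theorem rebend_one {α γ δ : Type*} [Fintype α] [DecidableEq α] (n : ℕ) (s : α ⊕ α ≃ γ ⊕ δ) :
    rebend (Fin n) s 1 = Dmat n (pairSetoid s) := by
  ext I J
  rw [rebend_apply, one_apply, Dmat, of_apply]
  refine if_congr ⟨fun h x y hxy => ?_, fun h => funext fun a => h _ _ ?_⟩ rfl rfl
  · have h' : ∀ z, Sum.elim I J (s z) = Sum.elim I J (s (Sum.inl (Sum.elim id id z))) := by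
      rintro (a | a)
      · rfl
      · exact (congrFun h a).symm
    have hxy : Sum.elim id id (s.symm x) = Sum.elim id id (s.symm y) := hxy
    have hx := h' (s.symm x)
    rw [hxy, ← h', s.apply_symm_apply, s.apply_symm_apply] at hx
    exact hx
  · change Sum.elim id id (s.symm _) = Sum.elim id id (s.symm _)
    simp

theorem ncard_of_mem_classes_pairSetoid {α X : Type*} (s : α ⊕ α ≃ X) {t : Set X}
    (ht : t ∈ (pairSetoid s).classes) : t.ncard = 2 := by
  obtain ⟨x, rfl⟩ := ht
  have : {y | (pairSetoid s) y x} = {s (Sum.inl (Sum.elim id id (s.symm x))),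
      s (Sum.inr (Sum.elim id id (s.symm x)))} := by
    ext y
    obtain ⟨y, rfl⟩ := s.surjective y
    obtain ⟨x, rfl⟩ := s.surjective x
    change Sum.elim id id (s.symm _) = Sum.elim id id (s.symm _) ↔ _
    cases x <;> cases y <;> simp
  rw [this, Set.ncard_pair (by simp)]

theorem colour_ne_of_pairSetoid {α X : Type*} (s : α ⊕ α ≃ X) {c : X → Bool}
    (hs : ∀ x, c (s x) = x.isRight) {x y : X} (h : (pairSetoid s) x y) (hxy : x ≠ y) :
    c x ≠ c y := by
  obtain ⟨y, rfl⟩ := s.surjective y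
  obtain ⟨x, rfl⟩ := s.surjective x
  have h : Sum.elim id id (s.symm (s x)) = Sum.elim id id (s.symm (s y)) := h
  rw [hs, hs]
  cases x <;> cases y <;> simp_all

theorem exists_eq_pairSetoid {X : Type*} (π : Setoid X) (c : X → Bool)
    (h2 : ∀ t ∈ π.classes, t.ncard = 2) (hc : ∀ x y, π x y → x ≠ y → c x ≠ c y) :
    ∃ s : Quotient π ⊕ Quotient π ≃ X, (∀ x, c (s x) = x.isRight) ∧ π = pairSetoid s := by
  let φ : X → Quotient π ⊕ Quotient π := fun x => if c x then Sum.inr ⟦x⟧ else Sum.inl ⟦x⟧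
  have hφr : ∀ x, (φ x).isRight = c x := fun x => by
    cases h : c x <;> simp [φ, h]
  have hφq : ∀ x, Sum.elim id id (φ x) = ⟦x⟧ := fun x => by
    cases h : c x <;> simp [φ, h]
  have hinj : φ.Injective := fun x y hxy => by
    by_contra hne
    have hq := congrArg (Sum.elim id id) hxy
    rw [hφq, hφq] at hq
    refine hc x y (Quotient.exact hq) hne ?_
    rw [← hφr, ← hφr, hxy]
  have hex : ∀ x b, ∃ y, π y x ∧ c y = b := fun x b => by
    by_cases hb : c x = b
    · exact ⟨x, π.refl x, hb⟩
    · obtain ⟨y, hy, hne⟩ := Set.exists_ne_of_one_lt_ncard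
        (by rw [h2 _ (π.mem_classes x)]; norm_num) x
      refine ⟨y, hy, ?_⟩
      have := hc y x hy hne
      grind
  have hsurj : φ.Surjective := by
    rintro (q | q) <;> induction q using Quotient.inductionOn with | _ x
    · obtain ⟨y, hy, hcy⟩ := hex x false
      exact ⟨y, by simpa [φ, hcy] using Quotient.sound hy⟩
    · obtain ⟨y, hy, hcy⟩ := hex x true
      exact ⟨y, by simpa [φ, hcy] using Quotient.sound hy⟩
  let s := Equiv.ofBijective φ ⟨hinj, hsurj⟩
  refine ⟨s.symm, fun x => ?_, Setoid.ext fun x y => ?_⟩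
  · obtain ⟨y, rfl⟩ := s.surjective x
    rw [s.symm_apply_apply]
    exact (hφr y).symm
  · change _ ↔ Sum.elim id id (φ x) = Sum.elim id id (φ y)
    rw [hφq, hφq]
    exact Quotient.eq.symm

theorem rebend_permMat {α γ δ : Type*} [Fintype α] [DecidableEq α] (n : ℕ)
    (s : α ⊕ α ≃ γ ⊕ δ) (σ : Equiv.Perm α) :
    rebend (Fin n) s (permMat α (Fin n) σ) =
      Dmat n (pairSetoid ((Equiv.sumCongr σ (Equiv.refl α)).trans s)) := by
  rw [← rebend_one]
  ext I J
  rw [rebend_apply, rebend_apply, permMat_apply, one_apply]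
  rfl

/-- A matrix intertwining tensor powers of different degrees vanishes. -/
theorem eq_zero_of_intertwines_of_card_ne {α β ι : Type*} [Fintype α] [DecidableEq α]
    [Fintype β] [DecidableEq β] [Fintype ι] [DecidableEq ι]
    (hne : Fintype.card α ≠ Fintype.card β) {M : Matrix (α → ι) (β → ι) ℂ}
    (hM : ∀ g : Matrix ι ι ℂ, g * gᴴ = 1 → gᴴ * g = 1 →
      M * piMat (fun _ : β => g) = piMat (fun _ : α => g) * M) : M = 0 := by
  set N := Fintype.card α + Fintype.card β + 1
  have hz := Complex.isPrimitiveRoot_exp N (by omega)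
  set z := Complex.exp (2 * Real.pi * Complex.I / N)
  have hz1 : z * star z = 1 := by
    have := hz.norm'_eq_one (by omega)
    simp [Complex.mul_conj, Complex.normSq_eq_norm_sq, this]
  have hg : (z • 1 : Matrix ι ι ℂ) * (z • 1)ᴴ = 1 := by
    rw [conjTranspose_smul, conjTranspose_one, smul_mul_smul_comm, hz1, one_smul, one_mul]
  have h := hM (z • 1) hg (mul_eq_one_comm.1 hg)
  rw [piMat_smul_one, piMat_smul_one, Matrix.mul_smul, Matrix.smul_mul, Matrix.mul_one,
    Matrix.one_mul, ← sub_eq_zero, ← sub_smul, smul_eq_zero, sub_eq_zero] at h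
  exact h.resolve_left fun h => hne (hz.pow_inj (by omega) (by omega) h).symm

/-- the set of matrices intertwining the two-coloured tensor power
representations `g^{⊗w_k}` and `g^{⊗w_l}` of the unitary group `U(n)` is the ℂ-linear
span of the partition matrices `D_π` of pair partitions whose blocks pair differently
coloured vertices within a row and identically coloured vertices across rows. -/
theorem stmt_17 (n : ℕ) (hn : 0 < n) (k l : ℕ)
    (wk : Fin k → Bool) (wl : Fin l → Bool) :
    {W : Matrix (Fin l → Fin n) (Fin k → Fin n) ℂ |
        ∀ g : Matrix (Fin n) (Fin n) ℂ, g * gᴴ = 1 → gᴴ * g = 1 →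
          W * tpowW n k wk g = tpowW n l wl g * W} =
      ↑(Submodule.span ℂ
          {D : Matrix (Fin l → Fin n) (Fin k → Fin n) ℂ |
            ∃ π : Setoid (Fin l ⊕ Fin k),
              (∀ s ∈ π.classes, s.ncard = 2) ∧
              (∀ x y : Fin l ⊕ Fin k, π.r x y → x ≠ y →
                ((x.isLeft = y.isLeft → Sum.elim wl wk x ≠ Sum.elim wl wk y) ∧
                 (x.isLeft ≠ y.isLeft → Sum.elim wl wk x = Sum.elim wl wk y))) ∧
              D = Dmat n π}) := by
  have hsign : ∀ x y : Fin l ⊕ Fin k,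
      ((x.isLeft = y.isLeft → Sum.elim wl wk x ≠ Sum.elim wl wk y) ∧
        (x.isLeft ≠ y.isLeft → Sum.elim wl wk x = Sum.elim wl wk y)) ↔
      signColour wl wk x ≠ signColour wl wk y := by
    rintro (x | x) (y | y) <;> simp [signColour]
  simp only [hsign, tpowW_eq_piMat]
  refine Set.Subset.antisymm (fun W hW => ?_) ?_
  · set c := signColour wl wk with hc
    let s : {x // ¬ c x} ⊕ {x // c x} ≃ Fin l ⊕ Fin k :=
      (Equiv.sumComm _ _).trans (Equiv.sumCompl fun x => (c x : Prop))
    have hs : ∀ x, c (s x) = x.isRight := by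
      rintro (⟨x, hx⟩ | ⟨x, hx⟩)
      · simpa [s] using hx
      · simpa [s] using hx
    by_cases hcard : Fintype.card {x // ¬ c x} = Fintype.card {x // c x}
    · let s' := (Equiv.sumCongr (Equiv.refl _) (Fintype.equivOfCardEq hcard)).trans s
      have hs' : ∀ x, c (s' x) = x.isRight := by
        rintro (x | x) <;> simp [s', hs]
      obtain ⟨M, rfl⟩ := (rebend (Fin n) s').surjective W
      have hM := mem_span_permMat_of_commute fun g hg hg' =>
        (rebend_intertwines_iff s' hs' hg M).1 (hW g hg hg')
      have := Submodule.mem_map_of_mem (f := (rebend (Fin n) s').toLinearMap) hM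
      rw [Submodule.map_span] at this
      refine Submodule.span_mono ?_ this
      rintro _ ⟨_, ⟨σ, rfl⟩, rfl⟩
      refine ⟨_, fun t => ncard_of_mem_classes_pairSetoid _, fun x y =>
        colour_ne_of_pairSetoid _ ?_, rebend_permMat n s' σ⟩
      rintro (x | x) <;> simp [hs']
    · obtain ⟨M, rfl⟩ := (rebend (Fin n) s).surjective W
      rw [eq_zero_of_intertwines_of_card_ne hcard fun g hg hg' =>
        (rebend_intertwines_iff s hs hg M).1 (hW g hg hg'), map_zero]
      exact Submodule.zero_mem _
  · intro W hW g hg hg'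
    induction hW using Submodule.span_induction with
    | mem D hD =>
      obtain ⟨π, h2, hπ, rfl⟩ := hD
      obtain ⟨s, hs, hπs⟩ := exists_eq_pairSetoid π (signColour wl wk) h2 hπ
      rw [hπs, ← rebend_one, rebend_intertwines_iff s hs hg, Matrix.one_mul, Matrix.mul_one]
    | zero => simp
    | add x y _ _ hx hy => rw [Matrix.add_mul, Matrix.mul_add, hx, hy]
    | smul a x _ hx => rw [Matrix.smul_mul, Matrix.mul_smul, hx]
end
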